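/- arXiv:0902.2235 — 8 statements merged into one kernel-verified Lean document; each statement's English description precedes it below -/
import Mathlib

section
/- MacWilliams Equivalence Theorem for convolutional codes (matrix version): Let F be a finite field and let G, Ḡ ∈ F[z]^{k×n} be two polynomial matrices (not necessarily of rank k) such that wt(uG) = wt(uḠ) for all u ∈ F[z]^k. Then G and Ḡ are z-monomially equivalent, i.e. there exists a z-monomial matrix M ∈ F(z)^{n×n} such that Ḡ = GM as matrices over the field of rational functions F(z). -/
open Matrix Polynomial

variable {F : Type*} [Field F]

/-- The weight of a polynomial row vector: the total number of nonzero
coefficients occurring in its entries. -/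
def wtP {n : ℕ} (v : Fin n → Polynomial F) : ℕ := ∑ i, (v i).support.card

/-- A `z`-monomial matrix over the rational function field `F(z)`:
permutation times `diag (α_i z^{μ_i})` with `α_i ∈ F*`, `μ_i ∈ ℤ`. -/
def IsZMonomial {n : ℕ} (M : Matrix (Fin n) (Fin n) (RatFunc F)) : Prop :=
  ∃ (σ : Equiv.Perm (Fin n)) (α : Fin n → Fˣ) (μ : Fin n → ℤ),
    ∀ i j, M i j =
      if σ i = j then algebraMap F (RatFunc F) (α j) * (RatFunc.X : RatFunc F) ^ (μ j) else 0


theorem AddChar.exists_eq_of_sum_eq {A ι κ : Type*} [AddCommGroup A]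
    (S : Finset ι) (T : Finset κ) (f : ι → AddChar A ℂ) (g : κ → AddChar A ℂ)
    (h : ∀ a, ∑ i ∈ S, f i a = ∑ j ∈ T, g j a) {i : ι} (hi : i ∈ S) :
    ∃ j ∈ T, f i = g j := by
  classical
  have hli : LinearIndependent ℂ (fun f : AddChar A ℂ => (f : A → ℂ)) :=
    (linearIndependent_monoidHom (Multiplicative A) ℂ).comp
      _ (AddChar.toMonoidHomEquiv (A := A) (M := ℂ)).injective
  have key : (∑ i ∈ S, Finsupp.single (f i) (1 : ℂ)) = ∑ j ∈ T, Finsupp.single (g j) (1 : ℂ) := by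
    apply hli
    simp only [map_sum, Finsupp.linearCombination_single, one_smul]
    ext a
    simpa using h a
  by_contra! hne
  have := DFunLike.congr_fun key (f i)
  simp only [Finsupp.finsetSum_apply, Finsupp.single_apply] at this
  rw [Finset.sum_eq_zero (s := T) fun j hj => if_neg fun e => hne j hj e.symm,
    Finset.sum_boole, Nat.cast_eq_zero, Finset.card_eq_zero] at this
  exact Finset.notMem_empty i (this ▸ Finset.mem_filter.2 ⟨hi, rfl⟩)

open Classical in
/-- Linear functionals on a vector space over a finite field, in two families of the same size
that vanish equally often at each vector: every member of the first family is a multiple of a member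
of the second. -/
theorem exists_eq_smul_of_card_ne_zero_eq {F V ι κ : Type*} [Field F] [Fintype F] [AddCommGroup V]
    [Module F V] (S : Finset ι) (T : Finset κ) (f : ι → V →ₗ[F] F) (g : κ → V →ₗ[F] F)
    (hcard : S.card = T.card)
    (h : ∀ v, (S.filter fun i => f i v ≠ 0).card = (T.filter fun j => g j v ≠ 0).card)
    {i : ι} (hi : i ∈ S) : ∃ j ∈ T, ∃ c : F, f i = c • g j := by
  have hchar : ringChar ℂ ≠ ringChar F := by
    rw [ringChar.eq_zero]
    exact fun e => CharP.ringChar_ne_zero_of_finite F e.symm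
  set χ := AddChar.FiniteField.primitiveChar_to_Complex F
  have hχ : χ.IsPrimitive := AddChar.FiniteField.primitiveChar_to_Complex_isPrimitive F
  let Φ (l : V →ₗ[F] F) : AddChar V ℂ := χ.compAddMonoidHom l.toAddMonoidHom
  have hΦ (l : V →ₗ[F] F) (v : V) : Φ l v = χ (l v) := rfl
  have hsum (l : V →ₗ[F] F) (v : V) :
      ∑ c : F, Φ (c • l) v = if l v = 0 then (Fintype.card F : ℂ) else 0 := by
    simp [hΦ, AddChar.sum_mulShift (l v) hχ]
  have hzero (v) : (S.filter fun i => f i v = 0).card = (T.filter fun j => g j v = 0).card := by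
    have h1 := S.card_filter_add_card_filter_not fun i => f i v = 0
    have h2 := T.card_filter_add_card_filter_not fun i => g i v = 0
    have h3 := h v
    simp only [ne_eq] at h3
    omega
  obtain ⟨⟨j, c⟩, hj, e⟩ := AddChar.exists_eq_of_sum_eq (S ×ˢ (Finset.univ : Finset F))
    (T ×ˢ (Finset.univ : Finset F)) (fun x => Φ (x.2 • f x.1)) (fun x => Φ (x.2 • g x.1))
    (fun v => by
      rw [Finset.sum_product, Finset.sum_product]
      simp only [hsum, ← Finset.sum_filter, Finset.sum_const, hzero v])
    (i := (i, 1)) (by simpa using hi)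
  refine ⟨j, (Finset.mem_product.1 hj).1, c, ?_⟩
  simp only [one_smul] at e
  ext v
  by_contra hv
  have hd : (f i - c • g j) v ≠ 0 := by simpa [sub_eq_zero] using hv
  refine hχ hd ?_
  ext x
  have := DFunLike.congr_fun e (x • v)
  rw [hΦ, hΦ] at this
  rw [AddChar.mulShift_apply, AddChar.one_apply, mul_comm, ← smul_eq_mul, ← map_smul,
    LinearMap.sub_apply, sub_eq_add_neg, AddChar.map_add_eq_mul, this, ← AddChar.map_add_eq_mul,
    add_neg_cancel, AddChar.map_zero_eq_one]

/-- Two columns of polynomials are equivalent when they agree up to a nonzero constant and a power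
of `X`. -/
def ZEquiv {ι F : Type*} [Field F] (a b : ι → F[X]) : Prop :=
  ∃ (c : F) (s t : ℕ), c ≠ 0 ∧ ∀ r, X ^ s * a r = C c * X ^ t * b r

theorem ZEquiv.symm {ι F : Type*} [Field F] {a b : ι → F[X]} (h : ZEquiv a b) : ZEquiv b a := by
  obtain ⟨c, s, t, hc, h⟩ := h
  refine ⟨c⁻¹, t, s, inv_ne_zero hc, fun r => ?_⟩
  rw [mul_assoc, h, ← mul_assoc, ← mul_assoc, ← C_mul, inv_mul_cancel₀ hc, C_1, one_mul]

theorem Polynomial.card_support_X_pow_mul {F : Type*} [Field F] (s : ℕ) (p : F[X]) :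
    (X ^ s * p).support.card = p.support.card := by
  rw [← Finset.card_map (addRightEmbedding s) (s := p.support)]
  congr 1
  ext N
  simp only [mem_support_iff, coeff_X_pow_mul', Finset.mem_map, addRightEmbedding_apply]
  constructor
  · intro h
    split_ifs at h with hs
    · exact ⟨N - s, h, Nat.sub_add_cancel hs⟩
    · exact absurd rfl h
  · rintro ⟨m, hm, rfl⟩
    simpa using hm

theorem Polynomial.card_support_C_mul {F : Type*} [Field F] {c : F} (hc : c ≠ 0) (p : F[X]) :
    (C c * p).support.card = p.support.card := by
  congr 1
  ext N
  simp [hc]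

theorem ZEquiv.card_support_dotProduct {ι F : Type*} [Fintype ι] [Field F] {a b : ι → F[X]}
    (h : ZEquiv a b) (u : ι → F[X]) : (u ⬝ᵥ a).support.card = (u ⬝ᵥ b).support.card := by
  obtain ⟨c, s, t, hc, h⟩ := h
  have e : X ^ s * (u ⬝ᵥ a) = C c * (X ^ t * (u ⬝ᵥ b)) := by
    simp only [dotProduct, Finset.mul_sum]
    refine Finset.sum_congr rfl fun r _ => ?_
    linear_combination u r * h r
  rw [← card_support_X_pow_mul s, e, card_support_C_mul hc, card_support_X_pow_mul]

theorem Polynomial.eq_of_coeff_eq_of_card_support_le {F : Type*} [Field F] {p q : F[X]}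
    (h : ∀ N, p.coeff N ≠ 0 → p.coeff N = q.coeff N) (hcard : q.support.card ≤ p.support.card) :
    p = q := by
  have hs : p.support = q.support := by
    refine Finset.eq_of_subset_of_card_le (fun N hN => ?_) hcard
    rw [mem_support_iff] at hN ⊢
    rwa [← h N hN]
  ext N
  by_cases hN : p.coeff N = 0
  · rw [hN]
    rw [← notMem_support_iff, hs, notMem_support_iff] at hN
    exact hN.symm
  · exact h N hN

theorem Polynomial.card_support_eq_card_filter_range {F : Type*} [Field F] [DecidableEq F]
    {p : F[X]} {N : ℕ} (hp : p.natDegree < N) :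
    p.support.card = ((Finset.range N).filter fun t => p.coeff t ≠ 0).card := by
  congr 1
  ext t
  simp only [mem_support_iff, Finset.mem_filter, Finset.mem_range, iff_and_self]
  exact fun ht => (le_natDegree_of_ne_zero ht).trans_lt hp

theorem Polynomial.natDegree_dotProduct_le {ι F : Type*} [Fintype ι] [Field F] {u a : ι → F[X]}
    {d e : ℕ} (hu : ∀ r, (u r).natDegree ≤ d) (ha : ∀ r, (a r).natDegree ≤ e) :
    (u ⬝ᵥ a).natDegree ≤ d + e :=
  natDegree_sum_le_of_forall_le _ _ fun r _ => natDegree_mul_le_of_le (hu r) (ha r)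

/-- The functional `u ↦ coeff t (u ⬝ᵥ a)` on polynomial vectors. -/
noncomputable def dotCoeff {ι F : Type*} [Fintype ι] [Field F] (a : ι → F[X]) (t : ℕ) :
    (ι → F[X]) →ₗ[F] F where
  toFun u := (u ⬝ᵥ a).coeff t
  map_add' u v := by rw [add_dotProduct, coeff_add]
  map_smul' c u := by rw [smul_dotProduct, coeff_smul, RingHom.id_apply]

theorem dotCoeff_single_X_pow {ι F : Type*} [Fintype ι] [DecidableEq ι] [Field F] (a : ι → F[X])
    (t : ℕ) (r : ι) (m : ℕ) :
    dotCoeff a t (Pi.single r (X ^ m)) = if m ≤ t then (a r).coeff (t - m) else 0 := by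
  simp [dotCoeff, coeff_X_pow_mul']

/-- If all entries have degree at most `D` and `b` has at most as many nonzero coefficients as `a`,
then matching the `D`-th coefficient functional of `a` with a multiple of some coefficient functional
of `b` on inputs of degree at most `D` makes `a` and `b` equivalent. -/
theorem ZEquiv.of_coeff_eq {ι F : Type*} [Fintype ι] [Field F] {a b : ι → F[X]} {D s : ℕ} {c : F}
    (hD : ∀ r, (a r).natDegree ≤ D) (ha : a ≠ 0)
    (hab : ∑ r, (b r).support.card ≤ ∑ r, (a r).support.card)
    (h : ∀ r, ∀ m ≤ D, (a r).coeff (D - m) = c * if m ≤ s then (b r).coeff (s - m) else 0) :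
    ZEquiv a b := by
  have hc : c ≠ 0 := by
    rintro rfl
    refine ha (funext fun r => Polynomial.ext fun N => ?_)
    by_cases hN : N ≤ D
    · simpa [Nat.sub_sub_self hN] using h r (D - N) (Nat.sub_le _ _)
    · exact coeff_eq_zero_of_natDegree_lt ((hD r).trans_lt (not_le.1 hN))
  have hcoeff (r N) (hN : (X ^ s * a r).coeff N ≠ 0) :
      (X ^ s * a r).coeff N = (C c * (X ^ D * b r)).coeff N := by
    rw [coeff_C_mul, coeff_X_pow_mul', coeff_X_pow_mul']
    rw [coeff_X_pow_mul'] at hN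
    split_ifs at hN with hsN
    · have hle : N - s ≤ D := (le_natDegree_of_ne_zero hN).trans (hD r)
      have := h r (D - (N - s)) (Nat.sub_le _ _)
      rw [Nat.sub_sub_self hle] at this
      rw [if_pos hsN, this]
      by_cases hDN : D ≤ N
      · rw [if_pos hDN, if_pos (by omega), show s - (D - (N - s)) = N - D by omega]
      · rw [if_neg hDN, if_neg (by omega)]
    · exact absurd rfl hN
  have hle (r) : (a r).support.card ≤ (b r).support.card := by
    rw [← card_support_X_pow_mul s (a r), ← card_support_X_pow_mul D (b r),
      ← card_support_C_mul hc (X ^ D * b r)]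
    refine Finset.card_le_card fun N hN => ?_
    rw [mem_support_iff] at hN ⊢
    rwa [← hcoeff r N hN]
  have heq := (Finset.sum_eq_sum_iff_of_le fun r _ => hle r).1
    (le_antisymm (Finset.sum_le_sum fun r _ => hle r) hab)
  refine ⟨c, s, D, hc, fun r => ?_⟩
  rw [mul_assoc]
  refine eq_of_coeff_eq_of_card_support_le (hcoeff r) ?_
  rw [card_support_C_mul hc, card_support_X_pow_mul, card_support_X_pow_mul,
    heq r (Finset.mem_univ r)]

theorem exists_zEquiv_of_forall_card_support_le {F ι κ : Type*} [Field F] [Fintype F] [Fintype κ]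
    {S T : Finset ι} {g g' : ι → κ → F[X]} (hcard : S.card = T.card)
    (h : ∀ u : κ → F[X],
      ∑ i ∈ S, (u ⬝ᵥ g i).support.card = ∑ j ∈ T, (u ⬝ᵥ g' j).support.card)
    {i : ι} (hi : i ∈ S)
    (hmax : ∀ j ∈ T, ∑ r, (g' j r).support.card ≤ ∑ r, (g i r).support.card) :
    ∃ j ∈ T, ZEquiv (g i) (g' j) := by
  classical
  by_cases h0 : g i = 0
  · obtain ⟨j, hj⟩ := Finset.card_pos.1 (hcard ▸ Finset.card_pos.2 ⟨i, hi⟩)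
    have hz := hmax j hj
    simp only [h0, Pi.zero_apply, support_zero, Finset.card_empty, Finset.sum_const_zero,
      Nat.le_zero, Finset.sum_eq_zero_iff, Finset.mem_univ, true_imp_iff, Finset.card_eq_zero,
      support_eq_empty] at hz
    exact ⟨j, hj, 1, 0, 0, one_ne_zero, fun r => by simp [h0, hz r]⟩
  let D := (S ×ˢ (Finset.univ : Finset κ)).sup (fun x => (g x.1 x.2).natDegree) ⊔
    (T ×ˢ (Finset.univ : Finset κ)).sup fun x => (g' x.1 x.2).natDegree
  have hS (i) (hi : i ∈ S) (r) : (g i r).natDegree ≤ D :=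
    le_sup_of_le_left (Finset.le_sup (f := fun x : ι × κ => (g x.1 x.2).natDegree)
      (b := (i, r)) (by simpa using hi))
  have hT (j) (hj : j ∈ T) (r) : (g' j r).natDegree ≤ D :=
    le_sup_of_le_right (Finset.le_sup (f := fun x : ι × κ => (g' x.1 x.2).natDegree)
      (b := (j, r)) (by simpa using hj))
  let V : Submodule F (κ → F[X]) := Submodule.pi Set.univ fun _ => degreeLE F D
  have hV (u : V) (r : κ) : (u.1 r).natDegree ≤ D :=
    natDegree_le_of_degree_le (mem_degreeLE.1 (u.2 r (Set.mem_univ r)))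
  have hwt {S : Finset ι} {g : ι → κ → F[X]} (hS : ∀ i ∈ S, ∀ r, (g i r).natDegree ≤ D) (u : V) :
      ((S ×ˢ Finset.range (D + D + 1)).filter
        fun x => (dotCoeff (g x.1) x.2 ∘ₗ V.subtype) u ≠ 0).card =
      ∑ i ∈ S, (u.1 ⬝ᵥ g i).support.card := by
    rw [Finset.card_filter, Finset.sum_product]
    refine Finset.sum_congr rfl fun i hi => ?_
    rw [card_support_eq_card_filter_range
      (Nat.lt_succ_of_le (natDegree_dotProduct_le (hV u) (hS i hi))), Finset.card_filter]
    rfl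
  obtain ⟨⟨j, s⟩, hjs, c, hc⟩ := exists_eq_smul_of_card_ne_zero_eq
    (S ×ˢ Finset.range (D + D + 1)) (T ×ˢ Finset.range (D + D + 1))
    (fun x => dotCoeff (g x.1) x.2 ∘ₗ V.subtype) (fun x => dotCoeff (g' x.1) x.2 ∘ₗ V.subtype)
    (by rw [Finset.card_product, Finset.card_product, hcard])
    (fun u => by convert (hwt hS u).trans ((h u.1).trans (hwt hT u).symm))
    (i := (i, D)) (by simp [hi])
  have hj := (Finset.mem_product.1 hjs).1
  refine ⟨j, hj, ZEquiv.of_coeff_eq (s := s) (c := c) (hS i hi) h0 (hmax j hj) fun r m hm => ?_⟩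
  have hmem : Pi.single r (X ^ m) ∈ V := fun r' _ => by
    rcases eq_or_ne r' r with rfl | hr
    · rw [Pi.single_eq_same]
      exact mem_degreeLE.2 <| (degree_X_pow_le m).trans (by exact_mod_cast hm)
    · rw [Pi.single_eq_of_ne hr]
      exact zero_mem _
  have := LinearMap.congr_fun hc ⟨_, hmem⟩
  simpa [dotCoeff_single_X_pow, hm] using this

theorem exists_zEquiv {F ι κ : Type*} [Field F] [Fintype F] [Fintype κ]
    {S T : Finset ι} {g g' : ι → κ → F[X]} (hcard : S.card = T.card) (hne : S.Nonempty)
    (h : ∀ u : κ → F[X],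
      ∑ i ∈ S, (u ⬝ᵥ g i).support.card = ∑ j ∈ T, (u ⬝ᵥ g' j).support.card) :
    ∃ i ∈ S, ∃ j ∈ T, ZEquiv (g i) (g' j) := by
  have hne' : T.Nonempty := Finset.card_pos.1 (hcard ▸ Finset.card_pos.2 hne)
  obtain ⟨i, hi, hi'⟩ := S.exists_max_image (fun i => ∑ r, (g i r).support.card) hne
  obtain ⟨j, hj, hj'⟩ := T.exists_max_image (fun j => ∑ r, (g' j r).support.card) hne'
  rcases le_total (∑ r, (g' j r).support.card) (∑ r, (g i r).support.card) with hle | hle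
  · exact ⟨i, hi, exists_zEquiv_of_forall_card_support_le hcard h hi
      fun j hj => (hj' j hj).trans hle⟩
  · obtain ⟨i, hi, hij⟩ := exists_zEquiv_of_forall_card_support_le hcard.symm
      (fun u => (h u).symm) hj fun i hi => (hi' i hi).trans hle
    exact ⟨i, hi, j, hj, hij.symm⟩

theorem exists_injOn_zEquiv {F ι κ : Type*} [Field F] [Fintype F] [Fintype κ]
    (S T : Finset ι) {g g' : ι → κ → F[X]} (hcard : S.card = T.card)
    (h : ∀ u : κ → F[X],
      ∑ i ∈ S, (u ⬝ᵥ g i).support.card = ∑ j ∈ T, (u ⬝ᵥ g' j).support.card) :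
    ∃ f : ι → ι, Set.MapsTo f S T ∧ Set.InjOn f S ∧ ∀ i ∈ S, ZEquiv (g i) (g' (f i)) := by
  classical
  induction hN : S.card generalizing S T with
  | zero =>
    rw [Finset.card_eq_zero] at hN
    subst hN
    exact ⟨id, by simp [Set.MapsTo]⟩
  | succ N ih =>
    obtain ⟨i, hi, j, hj, hij⟩ := exists_zEquiv hcard (Finset.card_pos.1 (by omega)) h
    obtain ⟨f, hmaps, hinj, hf⟩ := ih (S.erase i) (T.erase j)
      (by rw [Finset.card_erase_of_mem hi, Finset.card_erase_of_mem hj, hcard])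
      (fun u => by
        have := h u
        rw [← Finset.add_sum_erase S _ hi, ← Finset.add_sum_erase T _ hj,
          hij.card_support_dotProduct u] at this
        exact Nat.add_left_cancel this)
      (by rw [Finset.card_erase_of_mem hi, hN, Nat.add_sub_cancel])
    have hmem {x} (hx : x ∈ S) (hxi : x ≠ i) : f x ≠ j ∧ f x ∈ T :=
      Finset.mem_erase.1 (hmaps (Finset.mem_coe.2 (Finset.mem_erase.2 ⟨hxi, hx⟩)))
    refine ⟨Function.update f i j, fun x hx => ?_, fun x hx y hy hxy => ?_, fun x hx => ?_⟩
    · rcases eq_or_ne x i with rfl | hxi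
      · simpa using hj
      · rw [Function.update_of_ne hxi]
        exact (hmem hx hxi).2
    · rcases eq_or_ne x i with rfl | hxi <;> rcases eq_or_ne y x with rfl | hyx
      · rfl
      · rw [Function.update_self, Function.update_of_ne hyx] at hxy
        exact absurd hxy.symm (hmem hy hyx).1
      · rfl
      · rw [Function.update_of_ne hxi] at hxy
        rcases eq_or_ne y i with rfl | hyi
        · rw [Function.update_self] at hxy
          exact absurd hxy (hmem hx hxi).1
        · rw [Function.update_of_ne hyi] at hxy
          exact hinj (by simpa [hxi] using hx) (by simpa [hyi] using hy) hxy
    · rcases eq_or_ne x i with rfl | hxi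
      · rwa [Function.update_self]
      · rw [Function.update_of_ne hxi]
        exact hf x (Finset.mem_erase.2 ⟨hxi, hx⟩)

theorem ZEquiv.exists_algebraMap_eq {ι F : Type*} [Field F] {a b : ι → F[X]} (h : ZEquiv a b) :
    ∃ (c : Fˣ) (m : ℤ), ∀ r, algebraMap F[X] (RatFunc F) (b r) =
      algebraMap F[X] (RatFunc F) (a r) * (algebraMap F (RatFunc F) c * RatFunc.X ^ m) := by
  obtain ⟨c, s, t, hc, h⟩ := h.symm
  refine ⟨Units.mk0 c hc, t - s, fun r => ?_⟩
  have := congrArg (algebraMap F[X] (RatFunc F)) (h r)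
  simp only [map_mul, map_pow, RatFunc.algebraMap_X, RatFunc.algebraMap_C] at this
  have hX : (RatFunc.X : RatFunc F) ≠ 0 := RatFunc.X_ne_zero
  rw [zpow_sub₀ hX, zpow_natCast, zpow_natCast, Units.val_mk0, RatFunc.algebraMap_eq_C]
  field_simp
  linear_combination this

/-- **MacWilliams Equivalence Theorem for convolutional codes (matrix version).**
If `G` and `Ḡ` assign the same weight to every message, then they are
`z`-monomially equivalent over `F(z)`. -/
theorem stmt0 {F : Type*} [Field F] [Fintype F] {k n : ℕ}
    (G Gbar : Matrix (Fin k) (Fin n) (Polynomial F))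
    (h : ∀ u : Fin k → Polynomial F, wtP (u ᵥ* G) = wtP (u ᵥ* Gbar)) :
    ∃ M : Matrix (Fin n) (Fin n) (RatFunc F), IsZMonomial M ∧
      Gbar.map (fun p => algebraMap (Polynomial F) (RatFunc F) p) =
        G.map (fun p => algebraMap (Polynomial F) (RatFunc F) p) * M := by
  obtain ⟨f, -, hinj, hf⟩ := exists_injOn_zEquiv (Finset.univ : Finset (Fin n)) Finset.univ
    (g := Gᵀ) (g' := Gbarᵀ) rfl h
  rw [Finset.coe_univ, Set.injOn_univ] at hinj
  let σ : Equiv.Perm (Fin n) := Equiv.ofBijective f (Finite.injective_iff_bijective.1 hinj)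
  have hσ (j) : ZEquiv (Gᵀ (σ.symm j)) (Gbarᵀ j) := by
    have := hf (σ.symm j) (Finset.mem_univ _)
    rwa [show f (σ.symm j) = j from σ.apply_symm_apply j] at this
  choose α μ hαμ using fun j => (hσ j).exists_algebraMap_eq
  refine ⟨Matrix.of fun i j =>
    if σ i = j then algebraMap F (RatFunc F) (α j) * (RatFunc.X : RatFunc F) ^ (μ j) else 0,
    ⟨σ, α, μ, fun i j => rfl⟩, ?_⟩
  ext r j
  simpa [Matrix.mul_apply, ← Equiv.eq_symm_apply] using hαμ j r
end

section
/- MacWilliams Equivalence Theorem for convolutional codes (code version): Two convolutional codes C, C̄ ⊆ F[z]^n are isometric if and only if they are z-monomially equivalent. -/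
open Matrix Polynomial

variable {F : Type*} [Field F]

/-- The degree of a polynomial row vector: the maximal degree of its entries. -/
def degP {n : ℕ} (v : Fin n → Polynomial F) : ℕ := Finset.univ.sup fun i => (v i).natDegree

/-- The delay of a polynomial row vector: the least `t` such that the `t`-th
coefficient vector is nonzero. -/
noncomputable def delP {n : ℕ} (v : Fin n → Polynomial F) : ℕ :=
  sInf {t : ℕ | ∃ i, (v i).coeff t ≠ 0}

/-- A polynomial matrix is basic if its evaluation at every point of the algebraic
closure has full row rank. -/
def IsBasic {k n : ℕ} (G : Matrix (Fin k) (Fin n) (Polynomial F)) : Prop :=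
  ∀ lam : AlgebraicClosure F, (G.map fun p => (Polynomial.aeval lam) p).rank = k

/-- The set of codewords generated by the encoder `G`. -/
def codeOf {k n : ℕ} (G : Matrix (Fin k) (Fin n) (Polynomial F)) :
    Set (Fin n → Polynomial F) :=
  Set.range fun u : Fin k → Polynomial F => u ᵥ* G

/-- A convolutional code of length `n`: a submodule of `F[z]^n` generated by some
basic matrix. -/
def IsConvCode {n : ℕ} (C : Submodule (Polynomial F) (Fin n → Polynomial F)) : Prop :=
  ∃ (k : ℕ) (G : Matrix (Fin k) (Fin n) (Polynomial F)),
    IsBasic G ∧ (C : Set (Fin n → Polynomial F)) = codeOf G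

theorem exists_perm_of_card_fiber_eq {ι Q : Type*} [Fintype ι] [DecidableEq Q]
    (f g : ι → Q) (x₀ : Q)
    (h : ∀ x, x ≠ x₀ → (Finset.univ.filter fun i => f i = x).card =
      (Finset.univ.filter fun i => g i = x).card) :
    ∃ σ : Equiv.Perm ι, ∀ i, g (σ i) = f i := by
  have h₀ : ∀ x, (Finset.univ.filter fun i => f i = x).card =
      (Finset.univ.filter fun i => g i = x).card := by
    intro x
    by_cases hx : x = x₀
    · subst hx
      set T : Finset Q := insert x (Finset.univ.image f ∪ Finset.univ.image g) with hT
      have hf := Finset.card_eq_sum_card_fiberwise (s := Finset.univ) (t := T) (f := f)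
        (by intro i _; simp [hT])
      have hg := Finset.card_eq_sum_card_fiberwise (s := Finset.univ) (t := T) (f := g)
        (by intro i _; simp [hT])
      have hxT : x ∈ T := by simp [hT]
      rw [← Finset.add_sum_erase _ _ hxT] at hf hg
      have hs : ∑ y ∈ T.erase x, (Finset.univ.filter fun i => f i = y).card =
          ∑ y ∈ T.erase x, (Finset.univ.filter fun i => g i = y).card :=
        Finset.sum_congr rfl fun y hy => h y (Finset.ne_of_mem_erase hy)
      omega
    · exact h x hx
  refine ⟨Equiv.ofFiberEquiv (f := f) (g := g) fun x => Fintype.equivOfCardEq ?_, fun i =>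
    Equiv.ofFiberEquiv_map _ i⟩
  rw [Fintype.card_subtype, Fintype.card_subtype]
  exact h₀ x

open Classical in
theorem card_filter_smul_eq {F V I : Type*} [Field F] [Fintype F] [AddCommGroup V] [Module F V]
    [Fintype V] [Fintype I] (a b : I → V →ₗ[F] F)
    (h : ∀ u, (Finset.univ.filter fun i => a i u = 0).card =
      (Finset.univ.filter fun i => b i u = 0).card) {μ : V →ₗ[F] F} (hμ : μ ≠ 0) :
    (Finset.univ.filter fun i => ∃ c : F, c • a i = μ).card =
      (Finset.univ.filter fun i => ∃ c : F, c • b i = μ).card := by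
  obtain ⟨x, hx⟩ := exists_ne (0 : F)
  obtain ⟨ψ, hψ⟩ := AddChar.exists_apply_ne_zero.2 hx
  have hψ1 : ψ ≠ 1 := by
    rintro rfl
    exact hψ (by simp)
  have hprim := AddChar.IsPrimitive.of_ne_one hψ1
  have orth (ν : V →ₗ[F] F) : ∑ u, ψ (ν u) = if ν = 0 then (Fintype.card V : ℂ) else 0 := by
    have h1 := AddChar.sum_eq_ite (ψ.compAddMonoidHom ν.toAddMonoidHom)
    have h2 : ψ.compAddMonoidHom ν.toAddMonoidHom = 0 ↔ ν = 0 := by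
      constructor
      · intro h0
        ext v
        by_contra hv
        apply hψ
        have := DFunLike.congr_fun h0 ((x * (ν v)⁻¹) • v)
        simpa [AddChar.compAddMonoidHom_apply, mul_assoc, inv_mul_cancel₀ hv] using this
      · rintro rfl
        ext v
        simp
    simp only [h2] at h1
    simpa [AddChar.compAddMonoidHom_apply] using h1
  have key (ν : V →ₗ[F] F) : ∑ u, ψ (-μ u) * ((Fintype.card F : ℂ) * if ν u = 0 then 1 else 0) =
      (Fintype.card V : ℂ) * if ∃ c : F, c • ν = μ then 1 else 0 := by
    have h1 (u : V) : ((Fintype.card F : ℂ) * if ν u = 0 then 1 else 0) = ∑ c : F, ψ (c * ν u) := by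
      rw [AddChar.sum_mulShift _ hprim]
      split_ifs <;> simp
    have h2 : ∑ u, ψ (-μ u) * ((Fintype.card F : ℂ) * if ν u = 0 then 1 else 0) =
        ∑ c : F, ∑ u, ψ ((c • ν - μ) u) := by
      rw [Finset.sum_comm]
      refine Finset.sum_congr rfl fun u _ => ?_
      rw [h1, Finset.mul_sum]
      refine Finset.sum_congr rfl fun c _ => ?_
      rw [← AddChar.map_add_eq_mul]
      congr 1
      simp
      ring
    rw [h2]
    simp only [orth, sub_eq_zero]
    split_ifs with hc
    · obtain ⟨c, hc⟩ := hc
      rw [Finset.sum_eq_single c]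
      · simp [hc]
      · intro c' _ hne
        rw [if_neg]
        intro hc'
        apply hne
        obtain ⟨v, hv⟩ : ∃ v, μ v ≠ 0 := by
          by_contra! h0
          exact hμ (LinearMap.ext h0)
        have e1 : c * ν v = μ v := by rw [← hc]; rfl
        have e2 : c' * ν v = μ v := by rw [← hc']; rfl
        exact mul_right_cancel₀ (fun h0 => hv (by rw [← e1, h0, mul_zero])) (e2.trans e1.symm)
      · simp
    · rw [mul_zero]
      exact Finset.sum_eq_zero fun c _ => if_neg fun h0 => hc ⟨c, h0⟩
  have total (a : I → V →ₗ[F] F) :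
      ∑ u, ψ (-μ u) * ((Fintype.card F : ℂ) * ((Finset.univ.filter fun i => a i u = 0).card : ℂ)) =
      (Fintype.card V : ℂ) * ((Finset.univ.filter fun i => ∃ c : F, c • a i = μ).card : ℂ) := by
    simp only [Finset.card_filter, Nat.cast_sum, Finset.mul_sum]
    rw [Finset.sum_comm]
    refine Finset.sum_congr rfl fun i _ => ?_
    simpa using key (a i)
  have hab := (total a).symm.trans ((by simp only [h]) : _ = _) |>.trans (total b)
  have hV : (Fintype.card V : ℂ) ≠ 0 := by simp
  exact_mod_cast mul_left_cancel₀ hV hab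

theorem card_support_C_mul_X_pow_mul {F : Type*} [Field F] (c : Fˣ) (m : ℕ) (p : F[X]) :
    (C (c : F) * X ^ m * p).support.card = p.support.card := by
  symm
  refine Finset.card_bij (fun t _ => t + m) ?_ (by simp) ?_
  · intro t ht
    simpa [mul_assoc, coeff_X_pow_mul] using ht
  · intro t ht
    rw [mem_support_iff, mul_assoc, coeff_C_mul, coeff_X_pow_mul'] at ht
    split_ifs at ht with hm
    · exact ⟨t - m, by simpa using ht, by omega⟩
    · simp at ht

theorem exists_eq_X_pow_mul_of_coeff_zero {F κ : Type*} [Field F] (g : κ → F[X]) :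
    ∃ (m : ℕ) (g' : κ → F[X]), (∀ j, g j = X ^ m * g' j) ∧ (g' = 0 ∨ ∃ j, (g' j).coeff 0 ≠ 0) := by
  classical
  by_cases hg : ∃ m, ∃ j, (g j).coeff m ≠ 0
  · have hd (j : κ) : X ^ Nat.find hg ∣ g j := by
      rw [X_pow_dvd_iff]
      intro d hd
      by_contra h
      exact Nat.find_min hg hd ⟨j, h⟩
    choose g' hg' using hd
    refine ⟨Nat.find hg, g', hg', Or.inr ?_⟩
    obtain ⟨j, hj⟩ := Nat.find_spec hg
    refine ⟨j, ?_⟩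
    rw [hg' j, coeff_X_pow_mul'] at hj
    simpa using hj
  · push Not at hg
    exact ⟨0, 0, fun j => by ext t; simp [hg], Or.inl rfl⟩

/-- The linear functional on coefficient arrays sending the polynomial vector `u` with these
coefficients to the `t`-th coefficient of `∑ j, u j * g j`. -/
noncomputable def coeffFunctional {F κ : Type*} [Field F] [Fintype κ] (N : ℕ) (g : κ → F[X])
    (t : ℕ) : (κ → Fin N → F) →ₗ[F] F where
  toFun u := (∑ j, (∑ s, C (u j s) * X ^ (s : ℕ)) * g j).coeff t
  map_add' u v := by simp [add_mul, Finset.sum_add_distrib]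
  map_smul' c u := by
    simp [mul_assoc, Finset.mul_sum, Finset.sum_mul]

theorem coeffFunctional_single {F κ : Type*} [Field F] [Fintype κ] [DecidableEq κ] (N : ℕ)
    (g : κ → F[X]) (t : ℕ) (j : κ) (s : Fin N) :
    coeffFunctional N g t (Pi.single j (Pi.single s 1)) =
      if (s : ℕ) ≤ t then (g j).coeff (t - s) else 0 := by
  rw [← coeff_X_pow_mul']
  change (∑ j', (∑ s', C ((Pi.single j (Pi.single s 1) : κ → Fin N → F) j' s') * X ^ (s' : ℕ)) *
    g j').coeff t = _
  rw [Finset.sum_eq_single j, Finset.sum_eq_single s]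
  · simp
  · intro s' _ hs
    simp [hs]
  · simp
  · intro j' _ hj
    simp [hj]
  · simp

theorem coeffFunctional_smul {F κ : Type*} [Field F] [Fintype κ] (N : ℕ) (g : κ → F[X])
    (t : ℕ) (c : F) : coeffFunctional N (c • g) t = c • coeffFunctional N g t := by
  ext u
  simp [coeffFunctional, ← Finset.mul_sum]

theorem eq_smul_of_coeffFunctional_eq {F κ : Type*} [Field F] [Fintype κ] {D t : ℕ}
    {g w : κ → F[X]} (hgD : ∀ j, (g j).natDegree ≤ D) (hwD : ∀ j, (w j).natDegree ≤ D)
    (hg : g = 0 ∨ ∃ j, (g j).coeff 0 ≠ 0) (hw : ∃ j, (w j).coeff 0 ≠ 0) {c : F}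
    (h : c • coeffFunctional (2 * D + 1) g t = coeffFunctional (2 * D + 1) w D) :
    t = D ∧ c • g = w := by
  classical
  have hs (j : κ) (s : ℕ) (hsN : s < 2 * D + 1) :
      c * (if s ≤ t then (g j).coeff (t - s) else 0) =
        if s ≤ D then (w j).coeff (D - s) else 0 := by
    rw [← coeffFunctional_single (2 * D + 1) g t j ⟨s, hsN⟩,
      ← coeffFunctional_single (2 * D + 1) w D j ⟨s, hsN⟩, ← h]
    rfl
  obtain ⟨j₀, hj₀⟩ := hw
  have h₁ := hs j₀ D (by omega)
  simp only [le_refl, if_true, Nat.sub_self] at h₁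
  have hc : c ≠ 0 := by
    rintro rfl
    exact hj₀ (by rw [← h₁, zero_mul])
  have hDt : D ≤ t := by
    by_contra hlt
    rw [if_neg hlt, mul_zero] at h₁
    exact hj₀ h₁.symm
  rw [if_pos hDt] at h₁
  have hg₁ : (g j₀).coeff (t - D) ≠ 0 := fun h0 => hj₀ (by rw [← h₁, h0, mul_zero])
  have ht : t - D ≤ D := (le_natDegree_of_ne_zero hg₁).trans (hgD j₀)
  obtain ⟨j₁, hj₁⟩ : ∃ j, (g j).coeff 0 ≠ 0 := by
    rcases hg with rfl | hg
    · simp at hg₁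
    · exact hg
  have htD : t = D := by
    by_contra hne
    have h₂ := hs j₁ t (by omega)
    rw [if_pos le_rfl, if_neg (by omega), Nat.sub_self] at h₂
    exact (mul_ne_zero hc hj₁) h₂
  refine ⟨htD, ?_⟩
  subst htD
  funext j
  ext m
  by_cases hm : m ≤ t
  · have h₃ := hs j (t - m) (by omega)
    simpa [Nat.sub_sub_self hm] using h₃
  · rw [Pi.smul_apply, coeff_smul, coeff_eq_zero_of_natDegree_lt ((hgD j).trans_lt (by omega)),
      coeff_eq_zero_of_natDegree_lt ((hwD j).trans_lt (by omega)), smul_zero]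

theorem card_filter_coeff_ne_zero {F : Type*} [Field F] [DecidableEq F] {p : F[X]} {T : ℕ}
    (hp : p.natDegree < T) :
    (Finset.univ.filter fun t : Fin T => p.coeff t ≠ 0).card = p.support.card := by
  refine Finset.card_bij (fun t _ => (t : ℕ)) (by simp) (fun _ _ _ _ h => Fin.ext h) ?_
  intro t ht
  rw [mem_support_iff] at ht
  exact ⟨⟨t, (le_natDegree_of_ne_zero ht).trans_lt hp⟩, by simpa using ht, rfl⟩

open Classical in
theorem card_filter_smul_eq_of_weight_eq {F ι κ : Type*} [Field F] [Fintype F] [Fintype ι]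
    [Fintype κ] (g h : ι → κ → F[X])
    (hg : ∀ i, g i = 0 ∨ ∃ j, (g i j).coeff 0 ≠ 0) (hh : ∀ i, h i = 0 ∨ ∃ j, (h i j).coeff 0 ≠ 0)
    (hwt : ∀ u : κ → F[X], ∑ i, (∑ j, u j * g i j).support.card =
      ∑ i, (∑ j, u j * h i j).support.card) (w : κ → F[X]) (hw : ∃ j, (w j).coeff 0 ≠ 0) :
    (Finset.univ.filter fun i => ∃ c : F, c • g i = w).card =
      (Finset.univ.filter fun i => ∃ c : F, c • h i = w).card := by
  obtain ⟨D, hgD, hhD, hwD⟩ : ∃ D, (∀ i j, (g i j).natDegree ≤ D) ∧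
      (∀ i j, (h i j).natDegree ≤ D) ∧ ∀ j, (w j).natDegree ≤ D := by
    refine ⟨(∑ i, ∑ j, (g i j).natDegree) + (∑ i, ∑ j, (h i j).natDegree) +
      ∑ j, (w j).natDegree, fun i j => ?_, fun i j => ?_, fun j => ?_⟩
    · have h₁ := Finset.single_le_sum_of_canonicallyOrdered
        (f := fun i => ∑ j, (g i j).natDegree) (Finset.mem_univ i)
      have h₂ := Finset.single_le_sum_of_canonicallyOrdered
        (f := fun j => (g i j).natDegree) (Finset.mem_univ j)
      omega
    · have h₁ := Finset.single_le_sum_of_canonicallyOrdered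
        (f := fun i => ∑ j, (h i j).natDegree) (Finset.mem_univ i)
      have h₂ := Finset.single_le_sum_of_canonicallyOrdered
        (f := fun j => (h i j).natDegree) (Finset.mem_univ j)
      omega
    · have h₂ := Finset.single_le_sum_of_canonicallyOrdered
        (f := fun j => (w j).natDegree) (Finset.mem_univ j)
      omega
  let a (g : ι → κ → F[X]) (x : ι × Fin (3 * D + 1)) : (κ → Fin (2 * D + 1) → F) →ₗ[F] F :=
    coeffFunctional (2 * D + 1) (g x.1) x.2
  have hcount (g : ι → κ → F[X]) (hgD : ∀ i j, (g i j).natDegree ≤ D)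
      (u : κ → Fin (2 * D + 1) → F) :
      (Finset.univ.filter fun x => a g x u ≠ 0).card =
        ∑ i, (∑ j, (∑ s, C (u j s) * X ^ (s : ℕ)) * g i j).support.card := by
    rw [Finset.card_filter, Fintype.sum_prod_type]
    refine Finset.sum_congr rfl fun i _ => ?_
    rw [← card_filter_coeff_ne_zero (T := 3 * D + 1), Finset.card_filter]
    · rfl
    · rw [Nat.lt_succ_iff]
      refine natDegree_sum_le_of_forall_le _ _ fun j _ => natDegree_mul_le.trans ?_
      have h₁ : (∑ s : Fin (2 * D + 1), C (u j s) * X ^ (s : ℕ)).natDegree ≤ 2 * D :=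
        natDegree_sum_le_of_forall_le _ _ fun s _ =>
          (natDegree_C_mul_X_pow_le _ _).trans (by omega)
      have := hgD i j
      omega
  have hzero (u : κ → Fin (2 * D + 1) → F) :
      (Finset.univ.filter fun x => a g x u = 0).card =
        (Finset.univ.filter fun x => a h x u = 0).card := by
    have h₁ := hcount g hgD u
    have h₂ := hcount h hhD u
    rw [hwt, ← h₂] at h₁
    have h₃ := Finset.card_filter_add_card_filter_not (s := Finset.univ) fun x => a g x u = 0
    have h₄ := Finset.card_filter_add_card_filter_not (s := Finset.univ) fun x => a h x u = 0
    simp only [ne_eq] at h₁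
    omega
  have hμ : coeffFunctional (2 * D + 1) w D ≠ 0 := by
    intro h0
    obtain ⟨j, hj⟩ := hw
    apply hj
    simpa [h0] using (coeffFunctional_single (2 * D + 1) w D j ⟨D, by omega⟩).symm
  have hfiber (g : ι → κ → F[X]) (hgD : ∀ i j, (g i j).natDegree ≤ D)
      (hg : ∀ i, g i = 0 ∨ ∃ j, (g i j).coeff 0 ≠ 0) :
      (Finset.univ.filter fun i => ∃ c : F, c • g i = w).card =
        (Finset.univ.filter fun x => ∃ c : F, c • a g x =
          coeffFunctional (2 * D + 1) w D).card := by
    refine Finset.card_bij (fun i _ => (i, ⟨D, by omega⟩)) ?_ (by simp) ?_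
    · intro i hi
      obtain ⟨c, hc⟩ := (Finset.mem_filter.1 hi).2
      refine Finset.mem_filter.2 ⟨Finset.mem_univ _, c, ?_⟩
      rw [← hc, coeffFunctional_smul]
    · rintro ⟨i, t⟩ hx
      obtain ⟨c, hc⟩ := (Finset.mem_filter.1 hx).2
      obtain ⟨ht, hcw⟩ := eq_smul_of_coeffFunctional_eq (hgD i) hwD (hg i) hw hc
      exact ⟨i, Finset.mem_filter.2 ⟨Finset.mem_univ _, c, hcw⟩,
        Prod.ext rfl (Fin.ext ht.symm)⟩
  rw [hfiber g hgD hg, hfiber h hhD hh]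
  exact card_filter_smul_eq _ _ hzero hμ

/-- Encoder version of the MacWilliams theorem: two families of columns for which all linear
combinations have equal weight agree up to order, nonzero scalars and shifts. -/
theorem exists_perm_of_weight_eq {F ι κ : Type*} [Field F] [Fintype F] [Fintype ι] [Fintype κ]
    (g h : ι → κ → F[X])
    (hwt : ∀ u : κ → F[X], ∑ i, (∑ j, u j * g i j).support.card =
      ∑ i, (∑ j, u j * h i j).support.card) :
    ∃ (σ : Equiv.Perm ι) (c : ι → Fˣ) (a b : ι → ℕ), ∀ i j,
      X ^ a i * h (σ i) j = C (c i : F) * X ^ b i * g i j := by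
  classical
  choose m g' hgm hg' using fun i => exists_eq_X_pow_mul_of_coeff_zero (g i)
  choose l h' hhl hh' using fun i => exists_eq_X_pow_mul_of_coeff_zero (h i)
  have hshift (g g' : ι → κ → F[X]) (m : ι → ℕ) (hgm : ∀ i j, g i j = X ^ m i * g' i j)
      (u : κ → F[X]) (i : ι) :
      (∑ j, u j * g i j).support.card = (∑ j, u j * g' i j).support.card := by
    rw [← card_support_C_mul_X_pow_mul 1 (m i) (∑ j, u j * g' i j), Finset.mul_sum]
    congr 2
    refine Finset.sum_congr rfl fun j _ => ?_
    rw [hgm]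
    simp
    ring
  have hwt' (u : κ → F[X]) : ∑ i, (∑ j, u j * g' i j).support.card =
      ∑ i, (∑ j, u j * h' i j).support.card := by
    simpa only [hshift g g' m hgm, hshift h h' l hhl] using hwt u
  let q (x : κ → F[X]) : MulAction.orbitRel.Quotient Fˣ (κ → F[X]) := Quotient.mk'' x
  have hq (x y : κ → F[X]) : q x = q y ↔ ∃ c : Fˣ, c • y = x := by
    rw [Quotient.eq'']
    rfl
  have hq' (x y : κ → F[X]) (hy : y ≠ 0) : q x = q y ↔ ∃ c : F, c • x = y := by
    rw [eq_comm, hq]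
    constructor
    · rintro ⟨c, hc⟩
      exact ⟨c, hc⟩
    · rintro ⟨c, hc⟩
      refine ⟨Units.mk0 c ?_, hc⟩
      rintro rfl
      exact hy (by rw [← hc, zero_smul])
  obtain ⟨σ, hσ⟩ := exists_perm_of_card_fiber_eq (fun i => q (g' i)) (fun i => q (h' i)) (q 0) (by
    intro x
    induction x using Quotient.inductionOn' with | h w => ?_
    intro hx
    have hw : w ≠ 0 := by
      rintro rfl
      exact hx rfl
    change (Finset.univ.filter fun i => q (g' i) = q w).card =
      (Finset.univ.filter fun i => q (h' i) = q w).card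
    simp only [hq' _ _ hw]
    by_cases hw₀ : ∃ j, (w j).coeff 0 ≠ 0
    · convert card_filter_smul_eq_of_weight_eq g' h' hg' hh' hwt' w hw₀
    · have hempty (g : ι → κ → F[X]) (hg : ∀ i, g i = 0 ∨ ∃ j, (g i j).coeff 0 ≠ 0) (i : ι) :
          ¬ ∃ c : F, c • g i = w := by
        rintro ⟨c, rfl⟩
        rcases hg i with h0 | ⟨j, hj⟩
        · exact hw (by rw [h0, smul_zero])
        · refine hw₀ ⟨j, ?_⟩
          rw [Pi.smul_apply, coeff_smul, smul_eq_mul]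
          refine mul_ne_zero ?_ hj
          rintro rfl
          exact hw (zero_smul _ _)
      simp [hempty g' hg', hempty h' hh'])
  choose c hc using fun i => (hq _ _).1 (hσ i)
  refine ⟨σ, c, m, fun i => l (σ i), fun i j => ?_⟩
  have hcj : h' (σ i) j = C (c i : F) * g' i j := by
    rw [← hc i, ← smul_eq_C_mul]
    rfl
  rw [hhl, hgm, hcj]
  ring

theorem card_support_eq_of_algebraMap_eq {F : Type*} [Field F] {p q : F[X]} (c : Fˣ) (m : ℤ)
    (h : algebraMap F[X] (RatFunc F) q =
      algebraMap F[X] (RatFunc F) p * (algebraMap F (RatFunc F) c * RatFunc.X ^ m)) :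
    q.support.card = p.support.card := by
  have key : X ^ (-m).toNat * q = C (c : F) * X ^ m.toNat * p := by
    apply RatFunc.algebraMap_injective F
    have hX : (RatFunc.X : RatFunc F) ≠ 0 := RatFunc.X_ne_zero
    have hm : (RatFunc.X : RatFunc F) ^ m.toNat = RatFunc.X ^ (-m).toNat * RatFunc.X ^ m := by
      rw [← zpow_natCast, ← zpow_natCast, ← zpow_add₀ hX]
      congr 1
      omega
    simp only [map_mul, map_pow, RatFunc.algebraMap_X, RatFunc.algebraMap_C, h, hm,
      ← RatFunc.algebraMap_eq_C]
    ring
  rw [← card_support_C_mul_X_pow_mul 1 (-m).toNat q, ← card_support_C_mul_X_pow_mul c m.toNat p,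
    ← key]
  simp

theorem vecMul_apply_of_zMonomial {F : Type*} [Field F] {n : ℕ}
    {M : Matrix (Fin n) (Fin n) (RatFunc F)} {σ : Equiv.Perm (Fin n)} {α : Fin n → Fˣ}
    {μ : Fin n → ℤ}
    (hM : ∀ i j, M i j =
      if σ i = j then algebraMap F (RatFunc F) (α j) * (RatFunc.X : RatFunc F) ^ (μ j) else 0)
    (x : Fin n → RatFunc F) (i : Fin n) :
    (x ᵥ* M) (σ i) = x i * (algebraMap F (RatFunc F) (α (σ i)) * RatFunc.X ^ μ (σ i)) := by
  rw [vecMul, dotProduct, Finset.sum_eq_single i]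
  · rw [hM, if_pos rfl]
  · intro i' _ hi
    rw [hM, if_neg (fun h => hi (σ.injective h)), mul_zero]
  · simp

theorem IsZMonomial.exists_isometry {F : Type*} [Field F] {n : ℕ}
    {C Cbar : Submodule F[X] (Fin n → F[X])} {M : Matrix (Fin n) (Fin n) (RatFunc F)}
    (hM : IsZMonomial M)
    (hC : ((fun v : Fin n → F[X] => (fun i => algebraMap F[X] (RatFunc F) (v i)) ᵥ* M) '' C) =
      ((fun v : Fin n → F[X] => fun i => algebraMap F[X] (RatFunc F) (v i)) '' Cbar)) :
    ∃ φ : C ≃ₗ[F[X]] Cbar,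
      ∀ v : C, wtP ((φ v : Fin n → F[X])) = wtP (v : Fin n → F[X]) := by
  obtain ⟨σ, α, μ, hM⟩ := hM
  let ι : (Fin n → F[X]) →ₗ[F[X]] (Fin n → RatFunc F) :=
    (Algebra.linearMap F[X] (RatFunc F)).compLeft (Fin n)
  have hι : Function.Injective ι := fun v w h =>
    funext fun i => RatFunc.algebraMap_injective F (congrFun h i)
  let f : (Fin n → F[X]) →ₗ[F[X]] (Fin n → RatFunc F) :=
    (M.vecMulLinear.restrictScalars F[X]).comp ι
  have hf (v : Fin n → F[X]) (i : Fin n) : f v (σ i) = algebraMap F[X] (RatFunc F) (v i) *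
      (algebraMap F (RatFunc F) (α (σ i)) * RatFunc.X ^ μ (σ i)) :=
    vecMul_apply_of_zMonomial hM _ i
  have hf_inj : Function.Injective f := by
    intro v w h
    funext i
    apply RatFunc.algebraMap_injective F
    have := congrFun h (σ i)
    rw [hf, hf] at this
    refine mul_right_cancel₀ (mul_ne_zero ?_ (zpow_ne_zero _ RatFunc.X_ne_zero)) this
    simp
  have hmap : C.map f = Cbar.map ι := SetLike.coe_injective hC
  let φ : C ≃ₗ[F[X]] Cbar := (C.equivMapOfInjective f hf_inj).trans
    ((LinearEquiv.ofEq _ _ hmap).trans (Cbar.equivMapOfInjective ι hι).symm)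
  have hφ (v : C) : ι (φ v) = f v := by
    have h₁ : Cbar.equivMapOfInjective ι hι (φ v) =
        LinearEquiv.ofEq _ _ hmap (C.equivMapOfInjective f hf_inj v) := by
      simp [φ]
    exact congrArg Subtype.val h₁
  refine ⟨φ, fun v => ?_⟩
  rw [wtP, wtP, ← Equiv.sum_comp σ]
  refine Finset.sum_congr rfl fun i _ => ?_
  exact card_support_eq_of_algebraMap_eq (α (σ i)) (μ (σ i))
    ((congrFun (hφ v) (σ i)).trans (hf v i))

theorem exists_isZMonomial_of_isometry {F : Type*} [Field F] [Fintype F] {n : ℕ}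
    {C Cbar : Submodule F[X] (Fin n → F[X])} (hC : IsConvCode C) (φ : C ≃ₗ[F[X]] Cbar)
    (hφ : ∀ v : C, wtP ((φ v : Fin n → F[X])) = wtP (v : Fin n → F[X])) :
    ∃ M : Matrix (Fin n) (Fin n) (RatFunc F), IsZMonomial M ∧
      ((fun v : Fin n → F[X] => (fun i => algebraMap F[X] (RatFunc F) (v i)) ᵥ* M) '' C) =
        ((fun v : Fin n → F[X] => fun i => algebraMap F[X] (RatFunc F) (v i)) '' Cbar) := by
  obtain ⟨k, G, -, hG⟩ := hC
  have hrow (j : Fin k) : G j ∈ C := by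
    rw [← SetLike.mem_coe, hG]
    exact ⟨Pi.single j 1, by simp [Matrix.row]⟩
  let g : Fin n → Fin k → F[X] := fun i j => G j i
  let h : Fin n → Fin k → F[X] := fun i j => (φ ⟨G j, hrow j⟩ : Fin n → F[X]) i
  let enc (u : Fin k → F[X]) : C := ∑ j, u j • ⟨G j, hrow j⟩
  have henc (u : Fin k → F[X]) (i : Fin n) : (enc u : Fin n → F[X]) i = ∑ j, u j * g i j := by
    simp [enc, g]
  have hφenc (u : Fin k → F[X]) (i : Fin n) :
      (φ (enc u) : Fin n → F[X]) i = ∑ j, u j * h i j := by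
    simp only [enc, h, map_sum, map_smul, Submodule.coe_sum, Submodule.coe_smul, Finset.sum_apply,
      Pi.smul_apply, smul_eq_mul]
  have hsurj (v : C) : ∃ u, enc u = v := by
    have hv : (v : Fin n → F[X]) ∈ (C : Set (Fin n → F[X])) := v.2
    rw [hG] at hv
    obtain ⟨u, hu⟩ := hv
    refine ⟨u, Subtype.ext ?_⟩
    rw [← hu]
    funext i
    rw [henc]
    rfl
  obtain ⟨σ, c, a, b, hgh⟩ := exists_perm_of_weight_eq g h fun u => by
    simpa only [wtP, henc, hφenc] using (hφ (enc u)).symm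
  let M : Matrix (Fin n) (Fin n) (RatFunc F) := fun i j =>
    if σ i = j then algebraMap F (RatFunc F) (c (σ.symm j)) *
      (RatFunc.X : RatFunc F) ^ ((b (σ.symm j) : ℤ) - a (σ.symm j)) else 0
  have hM (v : C) : (fun i => algebraMap F[X] (RatFunc F) ((v : Fin n → F[X]) i)) ᵥ* M =
      fun i => algebraMap F[X] (RatFunc F) ((φ v : Fin n → F[X]) i) := by
    obtain ⟨u, rfl⟩ := hsurj v
    funext i'
    obtain ⟨i, rfl⟩ := σ.surjective i'
    rw [vecMul_apply_of_zMonomial (σ := σ) (α := fun j => c (σ.symm j))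
      (μ := fun j => (b (σ.symm j) : ℤ) - a (σ.symm j)) (fun _ _ => rfl)]
    have hX : (RatFunc.X : RatFunc F) ≠ 0 := RatFunc.X_ne_zero
    have key : X ^ a i * (φ (enc u) : Fin n → F[X]) (σ i) =
        Polynomial.C (c i : F) * X ^ b i * (enc u : Fin n → F[X]) i := by
      rw [hφenc, henc, Finset.mul_sum, Finset.mul_sum]
      refine Finset.sum_congr rfl fun j _ => ?_
      linear_combination u j * hgh i j
    have key' := congrArg (algebraMap F[X] (RatFunc F)) key
    simp only [map_mul, map_pow, RatFunc.algebraMap_X, RatFunc.algebraMap_C,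
      ← RatFunc.algebraMap_eq_C] at key'
    apply mul_left_cancel₀ (pow_ne_zero (a i) hX)
    rw [key']
    simp only [Equiv.symm_apply_apply]
    rw [zpow_sub₀ hX, zpow_natCast, zpow_natCast]
    field_simp
  refine ⟨M, ⟨σ, fun j => c (σ.symm j), fun j => (b (σ.symm j) : ℤ) - a (σ.symm j),
    fun _ _ => rfl⟩, ?_⟩
  ext x
  constructor
  · rintro ⟨v, hv, rfl⟩
    exact ⟨φ ⟨v, hv⟩, (φ ⟨v, hv⟩).2, (hM ⟨v, hv⟩).symm⟩
  · rintro ⟨w, hw, rfl⟩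
    refine ⟨φ.symm ⟨w, hw⟩, (φ.symm ⟨w, hw⟩).2, (hM _).trans ?_⟩
    rw [LinearEquiv.apply_symm_apply]

/-- **MacWilliams Equivalence Theorem for convolutional codes (code version).**
Two convolutional codes are isometric iff they are `z`-monomially equivalent. -/
theorem stmt1 {F : Type*} [Field F] [Fintype F] {n : ℕ}
    (C Cbar : Submodule (Polynomial F) (Fin n → Polynomial F))
    (hC : IsConvCode C) (hCbar : IsConvCode Cbar) :
    (∃ φ : C ≃ₗ[Polynomial F] Cbar,
       ∀ v : C, wtP ((φ v : Fin n → Polynomial F)) = wtP (v : Fin n → Polynomial F))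
    ↔ ∃ M : Matrix (Fin n) (Fin n) (RatFunc F), IsZMonomial M ∧
        ((fun v : Fin n → Polynomial F =>
            (fun i => algebraMap (Polynomial F) (RatFunc F) (v i)) ᵥ* M) '' C)
          = ((fun v : Fin n → Polynomial F =>
              fun i => algebraMap (Polynomial F) (RatFunc F) (v i)) '' Cbar) := by
  exact ⟨fun ⟨φ, hφ⟩ => exists_isZMonomial_of_isometry hC φ hφ,
    fun ⟨_, hM, h⟩ => hM.exists_isometry h⟩
end

section
/- Let F be a finite field and let G, Ḡ ∈ F[z]^{k×n} be basic matrices that are delay-free in every component, i.e. each nonzero column of G and each nonzero column of Ḡ has a nonzero constant term. Then wt(uG) = wt(uḠ) for all u ∈ F[z]^k if and only if G and Ḡ are monomially equivalent, i.e. Ḡ = GM for some monomial matrix M ∈ GL_n(F). -/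
open Matrix Polynomial

variable {F : Type*} [Field F]

/-- A monomial matrix over `F`: permutation times invertible diagonal. -/
def IsMonomialMatrix {n : ℕ} (M : Matrix (Fin n) (Fin n) F) : Prop :=
  ∃ (σ : Equiv.Perm (Fin n)) (d : Fin n → Fˣ),
    ∀ i j, M i j = if σ i = j then (d j : F) else 0


/-- A polynomial matrix is delay-free in every component if each of its nonzero
columns has a nonzero constant term. -/
def DelayFree {F : Type*} [Field F] {k n : ℕ} (G : Matrix (Fin k) (Fin n) (Polynomial F)) :
    Prop :=
  ∀ j, (∃ i, G i j ≠ 0) → ∃ i, (G i j).coeff 0 ≠ 0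

theorem card_dual_ne_zero {V : Type*} [AddCommGroup V] [Module F V] [Finite F] [Finite V]
    {f : Module.Dual F V} (hf : f ≠ 0) :
    Nat.card {v : V // f v ≠ 0} =
      Nat.card F ^ Module.finrank F V - Nat.card F ^ (Module.finrank F V - 1) := by
  classical
  have := Fintype.ofFinite V
  have h1 : Nat.card (LinearMap.ker f) = Nat.card F ^ (Module.finrank F V - 1) := by
    rw [Module.natCard_eq_pow_finrank (K := F), ← Module.Dual.finrank_ker_add_one_of_ne_zero hf,
      Nat.add_sub_cancel]
  have h2 := Module.natCard_eq_pow_finrank (K := F) (V := V)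
  rw [← h1, ← h2, Nat.card_eq_fintype_card, Nat.card_eq_fintype_card, Fintype.card_subtype_compl]
  congr 1
  rw [← Nat.card_eq_fintype_card]
  exact Nat.card_congr (Equiv.refl _)

theorem sum_card_dual_ne_zero {V ι : Type*} [AddCommGroup V] [Module F V] [Finite F] [Fintype V]
    [DecidableEq F] [Fintype ι] [DecidableEq (Module.Dual F V)] (φ : ι → Module.Dual F V) :
    ∑ v : V, (Finset.univ.filter fun i => φ i v ≠ 0).card =
      (Finset.univ.filter fun i => φ i ≠ 0).card *
        (Nat.card F ^ Module.finrank F V - Nat.card F ^ (Module.finrank F V - 1)) := by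
  simp_rw [Finset.card_filter]
  rw [Finset.sum_comm, Finset.sum_mul]
  refine Finset.sum_congr rfl fun i _ => ?_
  rw [← Finset.card_filter, ← Fintype.card_subtype, ← Nat.card_eq_fintype_card]
  by_cases h : φ i = 0
  · simp [h]
  · rw [card_dual_ne_zero h, if_pos h, one_mul]

/-- Families of functionals with the same weights have equally many nonzero members. -/
theorem card_ne_zero_eq_of_weight_eq {V ι : Type*} [AddCommGroup V] [Module F V] [Finite F]
    [Finite V] [DecidableEq F] [Fintype ι] [DecidableEq (Module.Dual F V)]
    (φ ψ : ι → Module.Dual F V)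
    (h : ∀ v, (Finset.univ.filter fun i => φ i v ≠ 0).card =
      (Finset.univ.filter fun i => ψ i v ≠ 0).card) :
    (Finset.univ.filter fun i => φ i ≠ 0).card = (Finset.univ.filter fun i => ψ i ≠ 0).card := by
  have := Fintype.ofFinite V
  rcases subsingleton_or_nontrivial V with hV | hV
  · simp [Subsingleton.elim _ (0 : Module.Dual F V)]
  have hsum := sum_card_dual_ne_zero φ
  rw [Finset.sum_congr rfl fun v _ => h v, sum_card_dual_ne_zero ψ] at hsum
  refine (Nat.eq_of_mul_eq_mul_right ?_ hsum).symm
  have hpos : 0 < Module.finrank F V := Module.finrank_pos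
  exact Nat.sub_pos_of_lt (Nat.pow_lt_pow_right Finite.one_lt_card (by omega))

/-- MacWilliams extension theorem: families of functionals with the same weights meet each
punctured line of the dual space equally often. -/
theorem card_smul_eq_of_weight_eq {V ι : Type*} [AddCommGroup V] [Module F V] [Finite F]
    [Finite V] [DecidableEq F] [Fintype ι] (φ ψ : ι → Module.Dual F V)
    (h : ∀ v, (Finset.univ.filter fun i => φ i v ≠ 0).card =
      (Finset.univ.filter fun i => ψ i v ≠ 0).card)
    {f : Module.Dual F V} (hf : f ≠ 0) :
    Nat.card {i // ∃ c : Fˣ, φ i = c • f} = Nat.card {i // ∃ c : Fˣ, ψ i = c • f} := by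
  classical
  have key : ∀ χ : ι → Module.Dual F V, Nat.card {i // ∃ c : Fˣ, χ i = c • f} +
      (Finset.univ.filter fun i => (χ i).domRestrict (LinearMap.ker f) ≠ 0).card =
      (Finset.univ.filter fun i => χ i ≠ 0).card := by
    intro χ
    rw [Nat.card_eq_fintype_card, Fintype.card_subtype, ← Finset.card_union_of_disjoint]
    · congr 1
      ext i
      simp only [Finset.mem_union, Finset.mem_filter, Finset.mem_univ, true_and]
      constructor
      · rintro (⟨c, hc⟩ | hi) h0
        · rw [hc, Units.smul_def] at h0
          exact (smul_ne_zero c.ne_zero hf) h0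
        · exact hi (by rw [h0]; rfl)
      · intro hi
        by_contra! hcon
        have hle : LinearMap.ker f ≤ LinearMap.ker (χ i) := fun v hv =>
          LinearMap.congr_fun hcon.2 ⟨v, hv⟩
        obtain ⟨c, hc⟩ : ∃ c : F, c • f = χ i := by
          have := mem_span_of_iInf_ker_le_ker (L := fun _ : Unit => f) (K := χ i) (by simpa using hle)
          simpa [Submodule.mem_span_singleton] using this
        have hc0 : c ≠ 0 := by
          rintro rfl
          exact hi (by simp [← hc])
        exact hcon.1 (Units.mk0 c hc0) hc.symm
    · rw [Finset.disjoint_left]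
      simp only [Finset.mem_filter, Finset.mem_univ, true_and, not_not]
      rintro i ⟨c, hc⟩
      ext ⟨v, hv⟩
      have hv' : f v = 0 := hv
      simp [hc, Units.smul_def, hv']
  have h1 := card_ne_zero_eq_of_weight_eq φ ψ h
  have h2 := card_ne_zero_eq_of_weight_eq
    (fun i => (φ i).domRestrict (LinearMap.ker f))
    (fun i => (ψ i).domRestrict (LinearMap.ker f)) fun v => h v
  have h3 := key φ
  have h4 := key ψ
  omega

/-- The functional sending a vector `u` of polynomials of degree less than `N` to the coefficient
of `z ^ t` in `∑ i, u i * h i`. -/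
noncomputable def coeffDual {k : ℕ} (N : ℕ) (h : Fin k → F[X]) (t : ℕ) :
    Module.Dual F (Fin k → degreeLT F N) where
  toFun u := (∑ i, (u i : F[X]) * h i).coeff t
  map_add' u v := by simp [add_mul, Finset.sum_add_distrib]
  map_smul' c u := by simp [Finset.mul_sum]

theorem coeffDual_units_smul {k : ℕ} (N : ℕ) (h : Fin k → F[X]) (t : ℕ) (c : Fˣ) :
    coeffDual N (c • h) t = c • coeffDual N h t := by
  refine LinearMap.ext fun u => ?_
  simp [coeffDual, Units.smul_def, Finset.mul_sum]

theorem coeffDual_single {k N : ℕ} (h : Fin k → F[X]) (t : ℕ) (i : Fin k) {s : ℕ}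
    (hs : s < N) :
    coeffDual N h t (Pi.single i ⟨X ^ s, mem_degreeLT.2 (by simpa using hs)⟩) =
      if s ≤ t then (h i).coeff (t - s) else 0 := by
  have : ∑ j, ((Pi.single i (⟨X ^ s, mem_degreeLT.2 (by simpa using hs)⟩ : degreeLT F N) :
      Fin k → degreeLT F N) j : F[X]) * h j = X ^ s * h i := by
    rw [Finset.sum_eq_single i]
    · simp
    · intro j _ hj
      simp [Pi.single_eq_of_ne hj]
    · simp
  rw [← coeff_X_pow_mul', ← this]
  rfl

theorem coeffDual_eq_smul_iff {k d : ℕ} {g h : Fin k → F[X]} (hg : ∀ i, (g i).natDegree ≤ d)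
    (hh : ∀ i, (h i).natDegree ≤ d) (hg0 : (∃ i, g i ≠ 0) → ∃ i, (g i).coeff 0 ≠ 0)
    (hh0 : ∃ i, (h i).coeff 0 ≠ 0) (t : ℕ) (c : Fˣ) :
    coeffDual (2 * d + 1) g t = c • coeffDual (2 * d + 1) h d ↔ t = d ∧ g = c • h := by
  refine ⟨fun heq => ?_, ?_⟩
  · have key : ∀ i s, s ≤ 2 * d → (if s ≤ t then (g i).coeff (t - s) else 0) =
        c * if s ≤ d then (h i).coeff (d - s) else 0 := by
      intro i s hs
      rw [← coeffDual_single g t i (Nat.lt_succ_of_le hs), heq,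
        ← coeffDual_single h d i (Nat.lt_succ_of_le hs)]
      rfl
    obtain ⟨i, hi⟩ := hh0
    have h1 := key i d (by omega)
    rw [if_pos le_rfl, Nat.sub_self] at h1
    have hne := mul_ne_zero c.ne_zero hi
    rw [← h1] at hne
    have hdt : d ≤ t := by
      by_contra hlt
      simp [hlt] at hne
    rw [if_pos hdt] at hne
    have htd : t - d ≤ d := (le_natDegree_of_ne_zero hne).trans (hg i)
    obtain ⟨j, hj⟩ := hg0 ⟨i, fun h0 => hne (by simp [h0])⟩
    have h2 := key j t (by omega)
    rw [if_pos le_rfl, Nat.sub_self] at h2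
    have htd' : t ≤ d := by
      by_contra hlt
      simp [hlt] at h2
      exact hj h2
    obtain rfl : t = d := le_antisymm htd' hdt
    refine ⟨rfl, ?_⟩
    ext i m
    by_cases hm : m ≤ t
    · have := key i (t - m) (by omega)
      rw [if_pos (by omega), if_pos (by omega), Nat.sub_sub_self hm] at this
      simpa [Units.smul_def] using this
    · have hg' := coeff_eq_zero_of_natDegree_lt ((hg i).trans_lt (not_le.1 hm))
      have hh' := coeff_eq_zero_of_natDegree_lt ((hh i).trans_lt (not_le.1 hm))
      simp [hg', hh', Units.smul_def]
  · rintro ⟨rfl, rfl⟩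
    exact coeffDual_units_smul _ _ _ _

theorem wtP_eq_card_coeff_ne_zero [DecidableEq F] {n T : ℕ} (v : Fin n → F[X])
    (hv : ∀ j, (v j).natDegree < T) :
    wtP v = (Finset.univ.filter fun p : Fin n × Fin T => (v p.1).coeff p.2 ≠ 0).card := by
  rw [Finset.card_filter, Fintype.sum_prod_type, wtP]
  refine Finset.sum_congr rfl fun j _ => ?_
  rw [Fin.sum_univ_eq_sum_range (fun t => if (v j).coeff t ≠ 0 then 1 else 0) T,
    ← Finset.card_filter]
  congr 1
  ext t
  simp only [mem_support_iff, Finset.mem_filter, Finset.mem_range]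
  exact ⟨fun ht => ⟨(le_natDegree_of_ne_zero ht).trans_lt (hv j), ht⟩, And.right⟩

theorem card_col_smul_eq_of_wtP_eq [Finite F] {k n : ℕ} {G H : Matrix (Fin k) (Fin n) F[X]}
    (hG : DelayFree G) (hH : DelayFree H)
    (hwt : ∀ u : Fin k → F[X], wtP (u ᵥ* G) = wtP (u ᵥ* H))
    {h : Fin k → F[X]} (hh : ∃ i, (h i).coeff 0 ≠ 0) :
    Nat.card {j // ∃ c : Fˣ, Gᵀ j = c • h} = Nat.card {j // ∃ c : Fˣ, Hᵀ j = c • h} := by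
  classical
  obtain ⟨d, hdG, hdH, hdh⟩ : ∃ d, (∀ i j, (G i j).natDegree ≤ d) ∧
      (∀ i j, (H i j).natDegree ≤ d) ∧ ∀ i, (h i).natDegree ≤ d := by
    obtain ⟨a, ha⟩ := (Set.finite_range fun p : Fin k × Fin n => (G p.1 p.2).natDegree).bddAbove
    obtain ⟨b, hb⟩ := (Set.finite_range fun p : Fin k × Fin n => (H p.1 p.2).natDegree).bddAbove
    obtain ⟨c, hc⟩ := (Set.finite_range fun i => (h i).natDegree).bddAbove
    refine ⟨max a (max b c), fun i j => ?_, fun i j => ?_, fun i => ?_⟩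
    · exact (ha ⟨(i, j), rfl⟩).trans (by omega)
    · exact (hb ⟨(i, j), rfl⟩).trans (by omega)
    · exact (hc ⟨i, rfl⟩).trans (by omega)
  have : Finite (degreeLT F (2 * d + 1)) := .of_equiv _ (degreeLTEquiv F (2 * d + 1)).symm.toEquiv
  have hdeg : ∀ (K : Matrix (Fin k) (Fin n) F[X]), (∀ i j, (K i j).natDegree ≤ d) →
      ∀ (u : Fin k → degreeLT F (2 * d + 1)) (j),
        (((fun i => (u i : F[X])) ᵥ* K) j).natDegree < 3 * d + 1 := by
    intro K hK u j
    rw [Nat.lt_succ_iff, Matrix.vecMul, dotProduct]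
    refine natDegree_sum_le_of_forall_le _ _ fun i _ => ?_
    have hu : (u i : F[X]).natDegree ≤ 2 * d := by
      by_cases h0 : (u i : F[X]) = 0
      · simp [h0]
      · exact Nat.le_of_lt_succ ((natDegree_lt_iff_degree_lt h0).2 (mem_degreeLT.1 (u i).2))
    have hKij := hK i j
    exact natDegree_mul_le.trans (by omega)
  have hf : coeffDual (2 * d + 1) h d ≠ 0 := by
    obtain ⟨i, hi⟩ := hh
    intro h0
    have := coeffDual_single h d i (show d < 2 * d + 1 by omega)
    rw [h0] at this
    simp at this
    exact hi this.symm
  have hcard := card_smul_eq_of_weight_eq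
    (fun p : Fin n × Fin (3 * d + 1) => coeffDual (2 * d + 1) (Gᵀ p.1) p.2)
    (fun p : Fin n × Fin (3 * d + 1) => coeffDual (2 * d + 1) (Hᵀ p.1) p.2)
    (fun u => by
      have := hwt fun i => (u i : F[X])
      rwa [wtP_eq_card_coeff_ne_zero _ (hdeg G hdG u),
        wtP_eq_card_coeff_ne_zero _ (hdeg H hdH u)] at this) hf
  have hred : ∀ K : Matrix (Fin k) (Fin n) F[X], DelayFree K → (∀ i j, (K i j).natDegree ≤ d) →
      Nat.card {p : Fin n × Fin (3 * d + 1) // ∃ c : Fˣ,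
        coeffDual (2 * d + 1) (Kᵀ p.1) p.2 = c • coeffDual (2 * d + 1) h d} =
      Nat.card {j // ∃ c : Fˣ, Kᵀ j = c • h} := by
    intro K hK hdK
    have hiff : ∀ (j) (t : ℕ) (c : Fˣ), coeffDual (2 * d + 1) (Kᵀ j) t =
        c • coeffDual (2 * d + 1) h d ↔ t = d ∧ Kᵀ j = c • h := fun j t c =>
      coeffDual_eq_smul_iff (fun i => hdK i j) hdh (hK j) hh t c
    simp_rw [hiff]
    exact Nat.card_congr
      { toFun := fun p => ⟨p.1.1, p.2.imp fun _ => And.right⟩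
        invFun := fun j => ⟨(j.1, ⟨d, by omega⟩), j.2.imp fun _ hc => ⟨rfl, hc⟩⟩
        left_inv := by
          rintro ⟨⟨j, t⟩, c, ht, hc⟩
          simp only [Subtype.mk.injEq, Prod.mk.injEq, true_and]
          exact Fin.ext ht.symm
        right_inv := fun _ => rfl }
  rwa [hred G hG hdG, hred H hH hdH] at hcard

/-- Two functions on a finite type whose fibres have equal size, except possibly over one point,
differ by a permutation. -/
theorem exists_perm_comp_eq_of_card_fiber_eq {ι α : Type*} [Finite ι] (a b : ι → α) (z : α)
    (h : ∀ x, x ≠ z → Nat.card {i // a i = x} = Nat.card {i // b i = x}) :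
    ∃ σ : Equiv.Perm ι, ∀ i, b (σ i) = a i := by
  classical
  have := Fintype.ofFinite ι
  have hne : Nat.card {i // a i ≠ z} = Nat.card {i // b i ≠ z} := by
    have key : ∀ f : ι → α, Nat.card {i // f i ≠ z} =
        ∑ x ∈ (Finset.univ.image a ∪ Finset.univ.image b ∪ Finset.univ.image f).erase z,
          Nat.card {i // f i = x} := by
      intro f
      rw [Nat.card_eq_fintype_card, Fintype.card_subtype,
        Finset.card_eq_sum_card_fiberwise (f := f)
          (t := (Finset.univ.image a ∪ Finset.univ.image b ∪ Finset.univ.image f).erase z)]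
      · refine Finset.sum_congr rfl fun x hx => ?_
        rw [Nat.card_eq_fintype_card, Fintype.card_subtype, Finset.filter_filter]
        congr 1
        ext i
        simp only [Finset.mem_filter, Finset.mem_univ, true_and]
        exact ⟨And.right, fun hi => ⟨hi ▸ (Finset.mem_erase.1 hx).1, hi⟩⟩
      · intro i hi
        simpa using hi
    rw [key a, key b]
    have e1 : Finset.univ.image a ∪ Finset.univ.image b ∪ Finset.univ.image a =
      Finset.univ.image a ∪ Finset.univ.image b ∪ Finset.univ.image b := by grind
    rw [e1]
    exact Finset.sum_congr rfl fun x hx => h x (Finset.mem_erase.1 hx).1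
  have hz : Nat.card {i // a i = z} = Nat.card {i // b i = z} := by
    simp only [Nat.card_eq_fintype_card, ne_eq, Fintype.card_subtype_compl] at hne ⊢
    have h1 := Fintype.card_subtype_le fun i => a i = z
    have h2 := Fintype.card_subtype_le fun i => b i = z
    omega
  have hall : ∀ x, Nonempty ({i // a i = x} ≃ {i // b i = x}) := fun x => by
    refine Finite.card_eq.1 ?_
    by_cases hx : x = z
    · rw [hx, hz]
    · exact h x hx
  exact ⟨Equiv.ofFiberEquiv fun x => (hall x).some, Equiv.ofFiberEquiv_map _⟩

theorem exists_perm_col_smul_of_wtP_eq [Finite F] {k n : ℕ} {G H : Matrix (Fin k) (Fin n) F[X]}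
    (hG : DelayFree G) (hH : DelayFree H)
    (hwt : ∀ u : Fin k → F[X], wtP (u ᵥ* G) = wtP (u ᵥ* H)) :
    ∃ σ : Equiv.Perm (Fin n), ∀ j, ∃ c : Fˣ, Hᵀ (σ j) = c • Gᵀ j := by
  obtain ⟨σ, hσ⟩ := exists_perm_comp_eq_of_card_fiber_eq
    (fun j => (Quotient.mk (MulAction.orbitRel Fˣ (Fin k → F[X])) (Gᵀ j)))
    (fun j => (Quotient.mk (MulAction.orbitRel Fˣ (Fin k → F[X])) (Hᵀ j)))
    (Quotient.mk _ 0) (by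
      intro x hx
      obtain ⟨h, rfl⟩ := Quotient.exists_rep x
      have hh : h ≠ 0 := fun h0 => hx (by rw [h0])
      simp only [Quotient.eq, MulAction.orbitRel_apply, MulAction.mem_orbit_iff]
      simp only [eq_comm (b := Gᵀ _), eq_comm (b := Hᵀ _)]
      by_cases h0 : ∃ i, (h i).coeff 0 ≠ 0
      · exact card_col_smul_eq_of_wtP_eq hG hH hwt h0
      have hempty : ∀ K : Matrix (Fin k) (Fin n) F[X], DelayFree K →
          IsEmpty {j // ∃ c : Fˣ, Kᵀ j = c • h} := by
        rintro K hK
        refine ⟨fun ⟨j, c, hc⟩ => h0 ?_⟩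
        have hK' : ∀ i, K i j = c • h i := fun i => congrFun hc i
        obtain ⟨i, hi⟩ := Function.ne_iff.1 hh
        obtain ⟨i', hi'⟩ := hK j ⟨i, by
          rw [hK', Units.smul_def]; exact smul_ne_zero c.ne_zero hi⟩
        refine ⟨i', fun h00 => hi' ?_⟩
        rw [hK', Units.smul_def, coeff_smul, h00, smul_zero]
      have := hempty G hG
      have := hempty H hH
      simp)
  refine ⟨σ, fun j => ?_⟩
  obtain ⟨c, hc⟩ := MulAction.mem_orbit_iff.1 (MulAction.orbitRel_apply.1 (Quotient.exact (hσ j)))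
  exact ⟨c, hc.symm⟩

theorem mul_map_C_apply_of_monomial {m n : ℕ} {M : Matrix (Fin n) (Fin n) F}
    {σ : Equiv.Perm (Fin n)} {d : Fin n → Fˣ}
    (hM : ∀ i j, M i j = if σ i = j then (d j : F) else 0) (A : Matrix (Fin m) (Fin n) F[X])
    (i : Fin m) (j : Fin n) :
    (A * M.map fun a => C a) i (σ j) = A i j * C (d (σ j) : F) := by
  rw [Matrix.mul_apply, Finset.sum_eq_single j]
  · simp [hM]
  · intro l _ hl
    simp [hM, hl]
  · simp

/-- Basic encoders that are delay-free in every component are isometric iff they are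
monomially equivalent. -/
theorem stmt2 {F : Type*} [Field F] [Fintype F] {k n : ℕ}
    (G Gbar : Matrix (Fin k) (Fin n) (Polynomial F))
    (hG : IsBasic G) (hGbar : IsBasic Gbar)
    (hdfG : DelayFree G) (hdfGbar : DelayFree Gbar) :
    (∀ u : Fin k → Polynomial F, wtP (u ᵥ* G) = wtP (u ᵥ* Gbar))
    ↔ ∃ M : Matrix (Fin n) (Fin n) F, IsMonomialMatrix M ∧
        Gbar = G * M.map (fun a => Polynomial.C a) := by
  constructor
  · intro hwt
    obtain ⟨σ, hσ⟩ := exists_perm_col_smul_of_wtP_eq hdfG hdfGbar hwt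
    choose c hc using hσ
    refine ⟨fun i j => if σ i = j then (c (σ.symm j) : F) else 0,
      ⟨σ, fun j => c (σ.symm j), fun _ _ => rfl⟩, ?_⟩
    ext1 i j
    obtain ⟨j, rfl⟩ := σ.surjective j
    rw [mul_map_C_apply_of_monomial (σ := σ) (d := fun j => c (σ.symm j)) fun _ _ => rfl,
      Equiv.symm_apply_apply, mul_comm, ← smul_eq_C_mul]
    exact congrFun (hc j) i
  · rintro ⟨M, ⟨σ, d, hM⟩, rfl⟩ u
    rw [wtP, wtP, ← Equiv.sum_comp σ fun j => ((u ᵥ* (G * M.map fun a => C a)) j).support.card]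
    refine Finset.sum_congr rfl fun j _ => ?_
    have hcol : (u ᵥ* (G * M.map fun a => C a)) (σ j) = (u ᵥ* G) j * C (d (σ j) : F) := by
      simp only [Matrix.vecMul, dotProduct, mul_map_C_apply_of_monomial hM, Finset.sum_mul,
        mul_assoc]
    congr 1
    ext t
    rw [hcol]
    simp [coeff_mul_C]
end

section
/- MacWilliams Equivalence Theorem for block codes: Let F be a finite field and let G, Ḡ ∈ F^{k×n} be two constant matrices (not necessarily of rank k) such that wt(uG) = wt(uḠ) for all u ∈ F^k. Then Ḡ = GM for some monomial matrix M ∈ GL_n(F). -/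
open Matrix Polynomial

variable {F : Type*} [Field F]

section MacWilliams

open Finset Module

variable {K V ι : Type*} [Field K] [AddCommGroup V] [Module K V]

/-- The functionals vanishing on `W` but not at a vector `v ∉ W` make up the proportion
`1 - 1 / |K|` of all functionals vanishing on `W`. -/
theorem card_dualAnnihilator_apply_ne_zero [Finite K] [Finite (Dual K V)]
    (W : Submodule K V) {v : V} (hv : v ∉ W) :
    Nat.card K * Nat.card {f : W.dualAnnihilator // f.1 v ≠ 0} =
      (Nat.card K - 1) * Nat.card W.dualAnnihilator := by
  classical
  let φ : W.dualAnnihilator →ₗ[K] K := (Dual.eval K V v).domRestrict W.dualAnnihilator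
  have hφ : Function.Surjective φ := by
    obtain ⟨f, hf, hW⟩ := Submodule.exists_le_ker_of_notMem hv
    refine LinearMap.surjective fun h0 => hf ?_
    exact LinearMap.congr_fun h0 ⟨f, (Submodule.mem_dualAnnihilator f).2 fun w hw => hW hw⟩
  have hker : Nat.card W.dualAnnihilator = Nat.card (LinearMap.ker φ) * Nat.card K := by
    have e := LinearMap.quotKerEquivOfSurjective (R := K) (M := W.dualAnnihilator) (M₂ := K) φ hφ
    rw [Submodule.card_eq_card_quotient_mul_card (LinearMap.ker φ), Nat.card_congr e.toEquiv]
  have hsum : Nat.card W.dualAnnihilator =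
      Nat.card (LinearMap.ker φ) + Nat.card {f : W.dualAnnihilator // f.1 v ≠ 0} := by
    rw [← Nat.card_sum]
    exact Nat.card_congr (Equiv.sumCompl fun f : W.dualAnnihilator => f ∈ LinearMap.ker φ).symm
  obtain ⟨q, hq⟩ : ∃ q, Nat.card K = q + 1 := Nat.exists_eq_succ_of_ne_zero Nat.card_pos.ne'
  rw [hq] at hker ⊢
  have hc : Nat.card {f : W.dualAnnihilator // f.1 v ≠ 0} = Nat.card (LinearMap.ker φ) * q := by
    linarith
  rw [hc, hker, Nat.add_sub_cancel]
  ring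

/-- The weights of the words `(f (x j))ⱼ` determine how many `x j` lie outside a subspace. -/
theorem card_notMem_mul_eq_sum_card [Finite K] [Fintype (Dual K V)] [Fintype ι]
    (x : ι → V) (W : Submodule K V) :
    Nat.card {j // x j ∉ W} * ((Nat.card K - 1) * Nat.card W.dualAnnihilator) =
      Nat.card K * ∑ᶠ f : W.dualAnnihilator, Nat.card {j // f.1 (x j) ≠ 0} := by
  classical
  have hswap : ∑ f : W.dualAnnihilator, Nat.card {j // f.1 (x j) ≠ 0} =
      ∑ j, Nat.card {f : W.dualAnnihilator // f.1 (x j) ≠ 0} := by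
    rw [← Nat.card_sigma, ← Nat.card_sigma]
    exact Nat.card_congr ⟨fun p => ⟨p.2.1, p.1, p.2.2⟩, fun p => ⟨p.2.1, p.1, p.2.2⟩,
      fun _ => rfl, fun _ => rfl⟩
  rw [finsum_eq_sum_of_fintype, hswap, mul_sum, Nat.card_eq_fintype_card (α := {j // x j ∉ W}),
    Fintype.card_subtype, ← smul_eq_mul, ← sum_const, sum_filter]
  refine sum_congr rfl fun j _ => ?_
  by_cases hj : x j ∈ W
  · rw [if_neg (not_not.2 hj)]
    have : IsEmpty {f : W.dualAnnihilator // f.1 (x j) ≠ 0} :=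
      ⟨fun f => f.2 ((Submodule.mem_dualAnnihilator _).1 f.1.2 _ hj)⟩
    simp
  · rw [if_pos hj]
    exact (card_dualAnnihilator_apply_ne_zero W hj).symm

theorem card_mem_eq_of_forall_dual [Finite K] [Finite (Dual K V)] [Finite ι] {x y : ι → V}
    (h : ∀ f : Dual K V, Nat.card {j // f (x j) ≠ 0} = Nat.card {j // f (y j) ≠ 0})
    (W : Submodule K V) : Nat.card {j // x j ∈ W} = Nat.card {j // y j ∈ W} := by
  classical
  cases nonempty_fintype (Dual K V)
  cases nonempty_fintype ι
  have hout : Nat.card {j // x j ∉ W} = Nat.card {j // y j ∉ W} := by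
    have hpos : 0 < (Nat.card K - 1) * Nat.card W.dualAnnihilator :=
      Nat.mul_pos (Nat.sub_pos_of_lt Finite.one_lt_card) Nat.card_pos
    refine Nat.eq_of_mul_eq_mul_right hpos ?_
    rw [card_notMem_mul_eq_sum_card, card_notMem_mul_eq_sum_card]
    simp_rw [h]
  have hx := Nat.card_congr (Equiv.sumCompl fun j => x j ∈ W)
  have hy := Nat.card_congr (Equiv.sumCompl fun j => y j ∈ W)
  rw [Nat.card_sum] at hx hy
  omega

theorem card_span_singleton_eq_add_card_mem_bot [Finite ι] (x : ι → V) {v : V} (hv : v ≠ 0) :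
    Nat.card {j // K ∙ x j = K ∙ v} + Nat.card {j // x j ∈ (⊥ : Submodule K V)} =
      Nat.card {j // x j ∈ K ∙ v} := by
  classical
  rw [← Nat.card_sum]
  have hdisj : Disjoint (fun j => K ∙ x j = K ∙ v) (fun j => x j ∈ (⊥ : Submodule K V)) := by
    rw [Pi.disjoint_iff]
    intro j
    rw [Prop.disjoint_iff, not_and_or, or_iff_not_imp_left, not_not]
    intro hj h0
    rw [(Submodule.mem_bot K).1 h0, Submodule.span_zero_singleton] at hj
    exact hv (Submodule.span_singleton_eq_bot.1 hj.symm)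
  refine (Nat.card_congr (subtypeOrEquiv _ _ hdisj)).symm.trans
    (Nat.card_congr (Equiv.subtypeEquivRight fun j => ?_))
  constructor
  · rintro (hj | hj)
    · exact hj ▸ Submodule.mem_span_singleton_self _
    · exact (bot_le : ⊥ ≤ K ∙ v) hj
  · intro hj
    obtain ⟨c, hc⟩ := Submodule.mem_span_singleton.1 hj
    rcases eq_or_ne c 0 with rfl | hc0
    · right
      simp [← hc]
    · left
      rw [← hc]
      exact Submodule.span_singleton_smul_eq (IsUnit.mk0 c hc0) v

/-- Families of vectors whose images under every functional have the same number of nonzero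
entries agree up to a permutation and scaling by units. -/
theorem exists_perm_units_smul_eq [Finite K] [Finite (Dual K V)] [Finite ι] {x y : ι → V}
    (h : ∀ f : Dual K V, Nat.card {j // f (x j) ≠ 0} = Nat.card {j // f (y j) ≠ 0}) :
    ∃ (σ : Equiv.Perm ι) (d : ι → Kˣ), ∀ j, y (σ j) = d (σ j) • x j := by
  have hspan (W : Submodule K V) :
      Nat.card {j // K ∙ x j = W} = Nat.card {j // K ∙ y j = W} := by
    by_cases hW : ∃ v, W = K ∙ v
    · obtain ⟨v, rfl⟩ := hW
      rcases eq_or_ne v 0 with rfl | hv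
      · simpa using card_mem_eq_of_forall_dual h ⊥
      · have hx := card_span_singleton_eq_add_card_mem_bot (K := K) x hv
        have hy := card_span_singleton_eq_add_card_mem_bot (K := K) y hv
        have h0 := card_mem_eq_of_forall_dual h ⊥
        have h1 := card_mem_eq_of_forall_dual h (K ∙ v)
        omega
    · have : IsEmpty {j // K ∙ x j = W} := ⟨fun j => hW ⟨_, j.2.symm⟩⟩
      have : IsEmpty {j // K ∙ y j = W} := ⟨fun j => hW ⟨_, j.2.symm⟩⟩
      simp
  have e (W : Submodule K V) : {j // K ∙ x j = W} ≃ {j // K ∙ y j = W} :=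
    Classical.choice (Finite.card_eq.1 (hspan W))
  obtain ⟨σ, hσ⟩ : ∃ σ : Equiv.Perm ι, ∀ j, K ∙ y (σ j) = K ∙ x j :=
    ⟨Equiv.ofFiberEquiv e, Equiv.ofFiberEquiv_map e⟩
  choose d hd using fun j => Submodule.span_singleton_eq_span_singleton.1 (hσ j).symm
  exact ⟨σ, fun j => d (σ.symm j), fun j => by simp [hd]⟩

end MacWilliams

/-- **MacWilliams Equivalence Theorem for block codes.** -/
theorem stmt3 {F : Type*} [Field F] [Fintype F] [DecidableEq F] {k n : ℕ}
    (G Gbar : Matrix (Fin k) (Fin n) F)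
    (h : ∀ u : Fin k → F, hammingNorm (u ᵥ* G) = hammingNorm (u ᵥ* Gbar)) :
    ∃ M : Matrix (Fin n) (Fin n) F, IsMonomialMatrix M ∧ Gbar = G * M := by
  have key (f : Module.Dual F (Fin k → F)) :
      Nat.card {j // f (Gᵀ j) ≠ 0} = Nat.card {j // f (Gbarᵀ j) ≠ 0} := by
    obtain ⟨u, rfl⟩ := (dotProductEquiv F (Fin k)).surjective f
    have hu := h u
    rw [hammingNorm, hammingNorm, ← Fintype.card_subtype, ← Fintype.card_subtype,
      ← Nat.card_eq_fintype_card, ← Nat.card_eq_fintype_card] at hu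
    exact hu
  have : Finite (Module.Dual F (Fin k → F)) := (dotProductEquiv F (Fin k)).toEquiv.finite_iff.1
    inferInstance
  obtain ⟨σ, d, hd⟩ := exists_perm_units_smul_eq key
  refine ⟨Matrix.of fun i j => if σ i = j then (d j : F) else 0, ⟨σ, d, fun _ _ => rfl⟩, ?_⟩
  ext a j
  obtain ⟨i, rfl⟩ := σ.surjective j
  have hi := congrFun (hd i) a
  simp only [Matrix.transpose_apply, Pi.smul_apply, Units.smul_def, smul_eq_mul] at hi
  simp [Matrix.mul_apply, hi, mul_comm]
end

section
/- Every F[z]-module isomorphism φ : C → C' between convolutional codes C, C' ⊆ F[z]^n is delay-preserving, that is, del(φ(v)) = del(v) for all nonzero v ∈ C. -/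
open Matrix Polynomial

variable {F : Type*} [Field F]

theorem mem_of_X_smul_mem {F : Type*} [Field F] {n : ℕ}
    {C : Submodule (Polynomial F) (Fin n → Polynomial F)} (hC : IsConvCode C)
    {w : Fin n → Polynomial F} (hw : (X : Polynomial F) • w ∈ C) : w ∈ C := by
  obtain ⟨k, G, hG, hCG⟩ := hC
  have mem_iff : ∀ x, x ∈ C ↔ ∃ u : Fin k → Polynomial F, u ᵥ* G = x := fun x => by
    rw [← SetLike.mem_coe, hCG]; rfl
  obtain ⟨u, hu⟩ := (mem_iff _).1 hw
  let f : Polynomial F →+* AlgebraicClosure F :=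
    (aeval (0 : AlgebraicClosure F) : Polynomial F →ₐ[F] AlgebraicClosure F)
  have hrows : LinearIndependent (AlgebraicClosure F) (G.map f).row := by
    rw [linearIndependent_iff_card_eq_finrank_span, Fintype.card_fin, Set.finrank,
      ← rank_eq_finrank_span_row]
    exact (hG 0).symm
  have hzero : (f ∘ u) ᵥ* G.map f = 0 := by
    ext j
    rw [← RingHom.map_vecMul, hu]
    simp [f]
  have hfu : f ∘ u = 0 :=
    vecMul_injective_iff.2 hrows (hzero.trans (zero_vecMul _).symm)
  have hdvd : ∀ i, X ∣ u i := fun i => by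
    have := congrFun hfu i
    simp only [Function.comp_apply, Pi.zero_apply, f, RingHom.coe_coe] at this
    rw [X_dvd_iff, coeff_zero_eq_eval_zero]
    rw [← map_zero (algebraMap F (AlgebraicClosure F)),
      aeval_algebraMap_apply_eq_algebraMap_eval] at this
    exact (algebraMap F (AlgebraicClosure F)).injective this
  choose u' hu' using hdvd
  refine (mem_iff _).2 ⟨u', smul_right_injective _ (X_ne_zero (R := F)) ?_⟩
  have : u = (X : Polynomial F) • u' := funext hu'
  simpa only [this, smul_vecMul] using hu

theorem mem_of_X_pow_smul_mem {F : Type*} [Field F] {n : ℕ}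
    {C : Submodule (Polynomial F) (Fin n → Polynomial F)} (hC : IsConvCode C) (m : ℕ)
    {w : Fin n → Polynomial F} (hw : (X ^ m : Polynomial F) • w ∈ C) : w ∈ C := by
  induction m with
  | zero => simpa using hw
  | succ m ih =>
    rw [pow_succ', mul_smul] at hw
    exact ih (mem_of_X_smul_mem hC hw)

theorem exists_eq_X_pow_delP_smul {F : Type*} [Field F] {n : ℕ} (v : Fin n → Polynomial F) :
    ∃ w : Fin n → Polynomial F, v = (X ^ delP v : Polynomial F) • w := by
  have hdvd : ∀ i, X ^ delP v ∣ v i := fun i => X_pow_dvd_iff.2 fun d hd => by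
    by_contra h
    exact Nat.notMem_of_lt_sInf hd ⟨i, h⟩
  choose w hw using hdvd
  exact ⟨w, funext hw⟩

theorem le_delP_X_pow_smul {F : Type*} [Field F] {n : ℕ} (m : ℕ) {w : Fin n → Polynomial F}
    (hw : (X ^ m : Polynomial F) • w ≠ 0) : m ≤ delP ((X ^ m : Polynomial F) • w) := by
  obtain ⟨i, hi⟩ := Function.ne_iff.1 hw
  obtain ⟨t, ht⟩ : ∃ t, (((X ^ m : Polynomial F) • w) i).coeff t ≠ 0 := by
    by_contra! h
    exact hi (Polynomial.ext fun t => by simpa using h t)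
  refine le_csInf ⟨t, i, ht⟩ ?_
  rintro s ⟨j, hj⟩
  by_contra! hs
  exact hj (X_pow_dvd_iff.1 (Dvd.intro (w j) rfl) s hs)

theorem delP_le_delP_map {F : Type*} [Field F] {n : ℕ}
    {C C' : Submodule (Polynomial F) (Fin n → Polynomial F)} (hC : IsConvCode C)
    (φ : C ≃ₗ[Polynomial F] C') (v : C) (hv : v ≠ 0) :
    delP (v : Fin n → Polynomial F) ≤ delP (φ v : Fin n → Polynomial F) := by
  obtain ⟨w, hw⟩ := exists_eq_X_pow_delP_smul (v : Fin n → Polynomial F)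
  have hwC : w ∈ C := mem_of_X_pow_smul_mem hC _ (hw ▸ v.2)
  have hφ : (φ v : Fin n → Polynomial F) =
      (X ^ delP (v : Fin n → Polynomial F) : Polynomial F) • (φ ⟨w, hwC⟩ : Fin n → Polynomial F) := by
    rw [← Submodule.coe_smul, ← map_smul]
    exact congrArg (fun x => (φ x : Fin n → Polynomial F)) (Subtype.ext hw)
  have hne : (φ v : Fin n → Polynomial F) ≠ 0 := by simpa using hv
  rw [hφ] at hne ⊢
  exact le_delP_X_pow_smul _ hne

/-- Every module isomorphism between convolutional codes is delay-preserving. -/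
theorem stmt4 {F : Type*} [Field F] [Fintype F] {n : ℕ}
    (C C' : Submodule (Polynomial F) (Fin n → Polynomial F))
    (hC : IsConvCode C) (hC' : IsConvCode C')
    (φ : C ≃ₗ[Polynomial F] C') (v : C) (hv : (v : Fin n → Polynomial F) ≠ 0) :
    delP ((φ v : Fin n → Polynomial F)) = delP (v : Fin n → Polynomial F) := by
  have hv' : v ≠ 0 := fun h => hv (by simp [h])
  refine le_antisymm ?_ (delP_le_delP_map hC φ v hv')
  simpa using delP_le_delP_map hC' φ.symm (φ v) (by simpa using hv')
end

section
/- Let C, C̄ ⊆ F[z]^n be convolutional codes, let φ : C → C̄ be an F[z]-module isomorphism, and suppose C = im G for a basic matrix G ∈ F[z]^{k×n}. Then there exists a basic matrix Ḡ ∈ F[z]^{k×n} such that C̄ = im Ḡ and φ(uG) = uḠ for all u ∈ F[z]^k. -/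
open Matrix Polynomial

variable {F : Type*} [Field F]

/-- Full row rank at a point makes left multiplication injective. -/
theorem vecMul_eq_zero_of_rank_eq {K : Type*} [Field K] {k n : ℕ} {A : Matrix (Fin k) (Fin n) K}
    (hA : A.rank = k) {v : Fin k → K} (hv : v ᵥ* A = 0) : v = 0 := by
  have hli : LinearIndependent K A.row := by
    rw [linearIndependent_iff_card_eq_finrank_span, Fintype.card_fin, Set.finrank,
      ← A.rank_eq_finrank_span_row, hA]
  exact Matrix.vecMul_injective_iff.mpr hli (hv.trans (Matrix.zero_vecMul A).symm)

/-- Left multiplication of polynomial vectors by a basic matrix is injective. -/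
theorem IsBasic.vecMul_injective {F : Type*} [Field F] {k n : ℕ}
    {G : Matrix (Fin k) (Fin n) (Polynomial F)} (hG : IsBasic G) :
    Function.Injective G.vecMulLinear := by
  rw [injective_iff_map_eq_zero]
  intro u hu
  rw [Matrix.vecMulLinear_apply] at hu
  have heval (lam : AlgebraicClosure F) : (fun i => aeval lam (u i)) = 0 := by
    refine vecMul_eq_zero_of_rank_eq (hG lam) ?_
    ext j
    simpa [Matrix.vecMul, dotProduct] using congrArg (aeval lam) (congrFun hu j)
  ext1 i
  apply Polynomial.map_injective _ (algebraMap F (AlgebraicClosure F)).injective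
  refine Polynomial.funext fun lam => ?_
  simpa [Polynomial.aeval_def, Polynomial.eval_map] using congrFun (heval lam) i

/-- A code with a basic `k`-row encoder is isomorphic to the message space, by encoding. -/
theorem IsBasic.exists_encoding_equiv {F : Type*} [Field F] {k n : ℕ}
    {G : Matrix (Fin k) (Fin n) (Polynomial F)} (hG : IsBasic G)
    {C : Submodule (Polynomial F) (Fin n → Polynomial F)}
    (hC : (C : Set (Fin n → Polynomial F)) = codeOf G) :
    ∃ e : (Fin k → Polynomial F) ≃ₗ[Polynomial F] C, ∀ u, (e u : Fin n → Polynomial F) = u ᵥ* G := by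
  obtain rfl : C = LinearMap.range G.vecMulLinear := SetLike.coe_injective hC
  exact ⟨LinearEquiv.ofInjective G.vecMulLinear hG.vecMul_injective, fun _ => rfl⟩

/-- A matrix whose row module contains that of a basic matrix of the same size is basic. -/
theorem IsBasic.of_codeOf_subset {F : Type*} [Field F] {k n : ℕ}
    {G H : Matrix (Fin k) (Fin n) (Polynomial F)} (hG : IsBasic G)
    (h : codeOf G ⊆ codeOf H) : IsBasic H := by
  have hrow (i : Fin k) : ∃ v : Fin k → Polynomial F, v ᵥ* H = G.row i :=
    h ⟨Pi.single i 1, Matrix.single_one_vecMul i G⟩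
  choose V hV using hrow
  have hmul : G = Matrix.of V * H := by
    ext1 i
    exact congrFun (hV i).symm
  intro lam
  refine le_antisymm (Matrix.rank_le_height _) ?_
  have hmap : (G.map fun p => aeval lam p) =
      ((Matrix.of V).map fun p => aeval lam p) * (H.map fun p => aeval lam p) := by
    rw [hmul]
    exact Matrix.map_mul (f := (aeval lam : Polynomial F →ₐ[F] AlgebraicClosure F).toRingHom)
  calc k = _ := (hG lam).symm
    _ ≤ _ := hmap ▸ Matrix.rank_mul_le_right _ _

/-- Every module isomorphism between convolutional codes is induced by a pair
of encoders. -/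
theorem stmt5 {F : Type*} [Field F] [Fintype F] {k n : ℕ}
    (C Cbar : Submodule (Polynomial F) (Fin n → Polynomial F))
    (hCbar : IsConvCode Cbar)
    (G : Matrix (Fin k) (Fin n) (Polynomial F)) (hG : IsBasic G)
    (hCG : (C : Set (Fin n → Polynomial F)) = codeOf G)
    (φ : C ≃ₗ[Polynomial F] Cbar) :
    ∃ Gbar : Matrix (Fin k) (Fin n) (Polynomial F), IsBasic Gbar ∧
      (Cbar : Set (Fin n → Polynomial F)) = codeOf Gbar ∧
      ∀ (u : Fin k → Polynomial F) (hu : u ᵥ* G ∈ C),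
        (φ ⟨u ᵥ* G, hu⟩ : Fin n → Polynomial F) = u ᵥ* Gbar := by
  obtain ⟨l, H, hH, hCH⟩ := hCbar
  obtain ⟨e, he⟩ := hG.exists_encoding_equiv hCG
  obtain ⟨f, -⟩ := hH.exists_encoding_equiv hCH
  obtain rfl : k = l := by
    simpa using (e.trans (φ.trans f.symm)).finrank_eq
  let ψ : (Fin k → Polynomial F) →ₗ[Polynomial F] Fin n → Polynomial F :=
    Cbar.subtype ∘ₗ (e.trans φ).toLinearMap
  have hψ (u : Fin k → Polynomial F) : u ᵥ* LinearMap.toMatrixRight' ψ = φ (e u) :=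
    LinearMap.congr_fun (LinearMap.toMatrixRight'.symm_apply_apply ψ) u
  have hcode : (Cbar : Set (Fin n → Polynomial F)) = codeOf (LinearMap.toMatrixRight' ψ) := by
    ext x
    constructor
    · intro hx
      exact ⟨e.symm (φ.symm ⟨x, hx⟩), by simp [hψ]⟩
    · rintro ⟨u, rfl⟩
      simp only [hψ]
      exact (φ (e u)).2
  refine ⟨_, hH.of_codeOf_subset (hCH.symm.trans hcode).subset, hcode, fun u hu => ?_⟩
  rw [hψ]
  congr 2
  exact Subtype.ext (he u).symm
end

section
/- Let C, C̄ ⊆ F[z]^n be convolutional codes, let φ : C → C̄ be a degree-preserving F[z]-module isomorphism (deg(φ(v)) = deg(v) for all nonzero v ∈ C), let C = im G for a basic and reduced matrix G ∈ F[z]^{k×n}, and let Ḡ ∈ F[z]^{k×n} be a matrix with C̄ = im Ḡ and φ(uG) = uḠ for all u ∈ F[z]^k. Then Ḡ is reduced with the same row degrees as G; in particular C and C̄ have the same Forney indices and the same degree. -/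
open Matrix Polynomial

variable {F : Type*} [Field F]

/-- The `i`-th row degree of a polynomial matrix. -/
def rowDeg {k n : ℕ} (G : Matrix (Fin k) (Fin n) (Polynomial F)) (i : Fin k) : ℕ :=
  Finset.univ.sup fun j => (G i j).natDegree

/-- The (internal) degree of a polynomial matrix: the maximal degree of its `k × k` minors. -/
noncomputable def degMat {k n : ℕ} (G : Matrix (Fin k) (Fin n) (Polynomial F)) : ℕ :=
  Finset.univ.sup fun f : Fin k ↪ Fin n => (Matrix.det fun i i' => G i (f i')).natDegree

/-- A polynomial matrix is reduced if the sum of its row degrees equals its degree. -/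
noncomputable def IsRowReduced {k n : ℕ} (G : Matrix (Fin k) (Fin n) (Polynomial F)) : Prop :=
  (∑ i, rowDeg G i) = degMat G


/-- The leading row coefficient matrix of a polynomial matrix. -/
noncomputable def leadMat {k n : ℕ} (G : Matrix (Fin k) (Fin n) F[X]) :
    Matrix (Fin k) (Fin n) F := fun i j => (G i j).coeff (rowDeg G i)

lemma natDegree_le_rowDeg {k n : ℕ} (G : Matrix (Fin k) (Fin n) F[X]) (i : Fin k) (j : Fin n) :
    (G i j).natDegree ≤ rowDeg G i :=
  Finset.le_sup (f := fun j => (G i j).natDegree) (Finset.mem_univ j)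

lemma exists_coeff_degP_ne_zero {n : ℕ} {v : Fin n → F[X]} (hv : v ≠ 0) :
    ∃ j, (v j).coeff (degP v) ≠ 0 := by
  obtain ⟨j₀, hj₀⟩ := Function.ne_iff.1 hv
  obtain ⟨j, -, hj⟩ := Finset.exists_mem_eq_sup Finset.univ ⟨j₀, Finset.mem_univ _⟩
    fun i => (v i).natDegree
  change degP v = _ at hj
  by_cases h : v j = 0
  · have h0 : degP v = 0 := by simp [hj, h]
    refine ⟨j₀, ?_⟩
    have hle : (v j₀).natDegree ≤ degP v :=
      Finset.le_sup (f := fun i => (v i).natDegree) (Finset.mem_univ j₀)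
    rw [show degP v = (v j₀).natDegree by omega]
    simpa using hj₀
  · refine ⟨j, ?_⟩
    rw [hj]
    simpa using h

lemma degP_eq_of_coeff_ne_zero {n d : ℕ} {v : Fin n → F[X]} (hle : ∀ j, (v j).natDegree ≤ d)
    (hne : ∃ j, (v j).coeff d ≠ 0) : degP v = d := by
  obtain ⟨j, hj⟩ := hne
  refine le_antisymm (Finset.sup_le fun j _ => hle j) ?_
  exact (le_natDegree_of_ne_zero hj).trans
    (Finset.le_sup (f := fun i => (v i).natDegree) (Finset.mem_univ j))

/-- The coefficient of a product of polynomials at the sum of given degree bounds. -/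
lemma coeff_prod_sum_of_natDegree_le {ι R : Type*} [CommSemiring R] (s : Finset ι) (f : ι → R[X])
    (d : ι → ℕ) (h : ∀ i ∈ s, (f i).natDegree ≤ d i) :
    (∏ i ∈ s, f i).coeff (∑ i ∈ s, d i) = ∏ i ∈ s, (f i).coeff (d i) := by
  classical
  induction s using Finset.induction_on with
  | empty => simp
  | insert a s ha ih =>
    rw [Finset.prod_insert ha, Finset.sum_insert ha, Finset.prod_insert ha,
      coeff_mul_add_eq_of_natDegree_le (h a (Finset.mem_insert_self a s)),
      ih fun i hi => h i (Finset.mem_insert_of_mem hi)]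
    exact (natDegree_prod_le _ _).trans
      (Finset.sum_le_sum fun i hi => h i (Finset.mem_insert_of_mem hi))

lemma natDegree_minor_le {k n : ℕ} (G : Matrix (Fin k) (Fin n) F[X]) (f : Fin k → Fin n) :
    (det fun i i' => G i (f i')).natDegree ≤ ∑ i, rowDeg G i := by
  change (G.submatrix id f).det.natDegree ≤ _
  rw [← det_transpose, det_apply]
  refine natDegree_sum_le_of_forall_le _ _ fun σ _ => ?_
  refine (natDegree_smul_le _ _).trans ((natDegree_prod_le _ _).trans ?_)
  exact Finset.sum_le_sum fun i _ => natDegree_le_rowDeg G i _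

lemma coeff_minor {k n : ℕ} (G : Matrix (Fin k) (Fin n) F[X]) (f : Fin k → Fin n) :
    (det fun i i' => G i (f i')).coeff (∑ i, rowDeg G i) =
      ((leadMat G).submatrix id f).det := by
  change (G.submatrix id f).det.coeff _ = _
  rw [← det_transpose, det_apply, ← det_transpose ((leadMat G).submatrix id f), det_apply,
    finsetSum_coeff]
  refine Finset.sum_congr rfl fun σ _ => ?_
  rw [Units.smul_def, Units.smul_def, coeff_smul]
  congr 1
  exact coeff_prod_sum_of_natDegree_le _ _ _ fun i _ => natDegree_le_rowDeg G i _

/-- A matrix over a field with linearly independent rows has a nonzero maximal minor. -/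
lemma exists_minor_ne_zero {k n : ℕ} {A : Matrix (Fin k) (Fin n) F}
    (hA : LinearIndependent F A.row) : ∃ f : Fin k ↪ Fin n, (A.submatrix id f).det ≠ 0 := by
  obtain ⟨κ, a, ha, hspan, hli⟩ := exists_linearIndependent' F A.col
  have : Fintype κ := Fintype.ofInjective a ha
  have hcard : Fintype.card κ = Fintype.card (Fin k) := by
    rw [← hA.rank_matrix, A.rank_eq_finrank_span_cols, ← hspan]
    exact linearIndependent_iff_card_eq_finrank_span.1 hli
  let e : Fin k ≃ κ := (Fintype.equivOfCardEq hcard).symm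
  refine ⟨⟨a ∘ e, ha.comp e.injective⟩, ?_⟩
  have hcols : LinearIndependent F (A.submatrix id (a ∘ e)).col := hli.comp e e.injective
  exact ((isUnit_iff_isUnit_det _).1 (linearIndependent_cols_iff_isUnit.1 hcols)).ne_zero

lemma degMat_le_sum_rowDeg {k n : ℕ} (G : Matrix (Fin k) (Fin n) F[X]) :
    degMat G ≤ ∑ i, rowDeg G i :=
  Finset.sup_le fun f _ => natDegree_minor_le G f

lemma isRowReduced_of_leadMat {k n : ℕ} {G : Matrix (Fin k) (Fin n) F[X]}
    (h : ∀ c, c ᵥ* leadMat G = 0 → c = 0) : IsRowReduced G := by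
  have hli : LinearIndependent F (leadMat G).row := by
    rw [← vecMul_injective_iff]
    exact (injective_iff_map_eq_zero (leadMat G).vecMulLinear).2 h
  obtain ⟨f, hf⟩ := exists_minor_ne_zero hli
  rw [← coeff_minor] at hf
  refine le_antisymm ((le_natDegree_of_ne_zero hf).trans ?_) (degMat_le_sum_rowDeg G)
  exact Finset.le_sup (f := fun f : Fin k ↪ Fin n => (det fun i i' => G i (f i')).natDegree)
    (Finset.mem_univ f)

lemma leadMat_vecMul_eq_zero {k n : ℕ} {G : Matrix (Fin k) (Fin n) F[X]} (hG : IsBasic G)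
    (hred : IsRowReduced G) {c : Fin k → F} (hc : c ᵥ* leadMat G = 0) : c = 0 := by
  rcases Nat.eq_zero_or_pos (∑ i, rowDeg G i) with h0 | hpos
  · have h0' : ∀ i, rowDeg G i = 0 := by simpa using h0
    have hmap : (G.map fun p => aeval (0 : AlgebraicClosure F) p) =
        (leadMat G).map (algebraMap F (AlgebraicClosure F)) := by
      ext i j
      simp only [map_apply, leadMat, h0']
      exact (coeff_zero_eq_aeval_zero' _).symm
    have hrank := hG 0
    rw [hmap] at hrank
    have hli : LinearIndependent (AlgebraicClosure F)
        ((leadMat G).map (algebraMap F (AlgebraicClosure F))).row := by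
      rw [linearIndependent_iff_card_eq_finrank_span, Set.finrank, ← rank_eq_finrank_span_row,
        hrank, Fintype.card_fin]
    rw [← vecMul_injective_iff] at hli
    have hc' : (algebraMap F (AlgebraicClosure F) ∘ c) ᵥ*
        (leadMat G).map (algebraMap F (AlgebraicClosure F)) = 0 := by
      ext j
      rw [← RingHom.map_vecMul, hc]
      simp
    have hz := hli (hc'.trans (zero_vecMul _).symm)
    ext i
    simpa using congrFun hz i
  · have hne : (Finset.univ : Finset (Fin k ↪ Fin n)).Nonempty := by
      by_contra hemp
      rw [Finset.not_nonempty_iff_eq_empty] at hemp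
      have : degMat G = 0 := by simp [degMat, hemp]
      rw [IsRowReduced] at hred
      omega
    obtain ⟨f, -, hf⟩ := Finset.exists_mem_eq_sup _ hne
      fun f : Fin k ↪ Fin n => (det fun i i' => G i (f i')).natDegree
    have hf' : ∑ i, rowDeg G i = (det fun i i' => G i (f i')).natDegree := hred.trans hf
    have hdet : ((leadMat G).submatrix id f).det ≠ 0 := by
      rw [← coeff_minor, hf', coeff_natDegree, Ne, leadingCoeff_eq_zero]
      intro hz
      rw [hz, natDegree_zero] at hf'
      omega
    refine eq_zero_of_vecMul_eq_zero hdet ?_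
    ext j
    exact congrFun hc (f j)

/-- If the entries of `u` satisfy `deg (u i) + rowDeg G i ≤ d` whenever `u i ≠ 0`, then `uG` has
degree at most `d`. -/
lemma natDegree_vecMul_le {k n d : ℕ} {G : Matrix (Fin k) (Fin n) F[X]} {u : Fin k → F[X]}
    (hu : ∀ i, u i ≠ 0 → (u i).natDegree + rowDeg G i ≤ d) (j : Fin n) :
    ((u ᵥ* G) j).natDegree ≤ d := by
  change (∑ i, u i * G i j).natDegree ≤ d
  refine natDegree_sum_le_of_forall_le _ _ fun i _ => ?_
  by_cases h : u i = 0
  · simp [h]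
  · exact natDegree_mul_le.trans ((Nat.add_le_add_left (natDegree_le_rowDeg G i j) _).trans (hu i h))

lemma coeff_vecMul {k n d : ℕ} {G : Matrix (Fin k) (Fin n) F[X]} {u : Fin k → F[X]}
    (hu : ∀ i, u i ≠ 0 → (u i).natDegree + rowDeg G i ≤ d) (j : Fin n) :
    ((u ᵥ* G) j).coeff d = ((fun i => (u i).coeff (d - rowDeg G i)) ᵥ* leadMat G) j := by
  simp only [vecMul, dotProduct, finsetSum_coeff]
  refine Finset.sum_congr rfl fun i _ => ?_
  by_cases h : u i = 0
  · simp [h]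
  · have := hu i h
    obtain ⟨e, rfl⟩ : ∃ e, d = e + rowDeg G i := ⟨d - rowDeg G i, by omega⟩
    rw [coeff_mul_add_eq_of_natDegree_le (by omega) (natDegree_le_rowDeg G i j),
      Nat.add_sub_cancel]
    rfl

/-- The predictable degree property: with independent leading rows, the bound of
`natDegree_vecMul_le` is attained as soon as it is attained by one entry of `u`. -/
lemma degP_vecMul {k n d : ℕ} {G : Matrix (Fin k) (Fin n) F[X]}
    (hG : ∀ c, c ᵥ* leadMat G = 0 → c = 0) {u : Fin k → F[X]}
    (hu : ∀ i, u i ≠ 0 → (u i).natDegree + rowDeg G i ≤ d)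
    (hd : ∃ i, u i ≠ 0 ∧ (u i).natDegree + rowDeg G i = d) :
    u ᵥ* G ≠ 0 ∧ degP (u ᵥ* G) = d := by
  obtain ⟨i, hi, rfl⟩ := hd
  have hne : ∃ j, ((u ᵥ* G) j).coeff ((u i).natDegree + rowDeg G i) ≠ 0 := by
    by_contra! hz
    have := congrFun (hG _ (funext fun j => (coeff_vecMul hu j).symm.trans (hz j))) i
    simp [hi] at this
  refine ⟨?_, degP_eq_of_coeff_ne_zero (natDegree_vecMul_le hu) hne⟩
  rintro h
  simp [h] at hne

/-- A degree-preserving isomorphism between convolutional codes maps a reduced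
encoder to a reduced encoder with the same row degrees; in particular the codes
have the same Forney indices and the same degree. -/
theorem stmt6 {F : Type*} [Field F] [Fintype F] {k n : ℕ}
    (C Cbar : Submodule (Polynomial F) (Fin n → Polynomial F))
    (hCbar : IsConvCode Cbar)
    (G : Matrix (Fin k) (Fin n) (Polynomial F)) (hG : IsBasic G) (hGred : IsRowReduced G)
    (hCG : (C : Set (Fin n → Polynomial F)) = codeOf G)
    (φ : C ≃ₗ[Polynomial F] Cbar)
    (hdeg : ∀ v : C, (v : Fin n → Polynomial F) ≠ 0 →
      degP ((φ v : Fin n → Polynomial F)) = degP (v : Fin n → Polynomial F))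
    (Gbar : Matrix (Fin k) (Fin n) (Polynomial F))
    (hCGbar : (Cbar : Set (Fin n → Polynomial F)) = codeOf Gbar)
    (hφG : ∀ (u : Fin k → Polynomial F) (hu : u ᵥ* G ∈ C),
      (φ ⟨u ᵥ* G, hu⟩ : Fin n → Polynomial F) = u ᵥ* Gbar) :
    IsRowReduced Gbar ∧ (∀ i, rowDeg Gbar i = rowDeg G i) ∧ degMat Gbar = degMat G := by
  have hlead : ∀ c, c ᵥ* leadMat G = 0 → c = 0 := fun c => leadMat_vecMul_eq_zero hG hGred
  have hmem (u : Fin k → F[X]) : u ᵥ* G ∈ C := by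
    rw [← SetLike.mem_coe, hCG]
    exact ⟨u, rfl⟩
  have hdeg' (u : Fin k → F[X]) (hu : u ᵥ* G ≠ 0) :
      u ᵥ* Gbar ≠ 0 ∧ degP (u ᵥ* Gbar) = degP (u ᵥ* G) := by
    rw [← hφG u (hmem u)]
    exact ⟨by simpa using hu, hdeg ⟨_, hmem u⟩ hu⟩
  have hrow (i : Fin k) : rowDeg Gbar i = rowDeg G i := by
    have hone : Pi.single i (1 : F[X]) ᵥ* G ≠ 0 := by
      refine (degP_vecMul (d := rowDeg G i) hlead (fun i' hi' => ?_) ⟨i, by simp, by simp⟩).1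
      obtain rfl : i' = i := by
        by_contra h
        simp [h] at hi'
      simp
    have := (hdeg' _ hone).2
    rwa [single_one_vecMul, single_one_vecMul] at this
  classical
  have hleadbar : ∀ c, c ᵥ* leadMat Gbar = 0 → c = 0 := by
    intro c hc
    by_contra hc0
    obtain ⟨i₀, hi₀⟩ := Function.ne_iff.1 hc0
    obtain ⟨i, hi, hmax⟩ := Finset.exists_max_image (Finset.univ.filter fun i => c i ≠ 0)
      (rowDeg G) ⟨i₀, by simpa using hi₀⟩
    simp only [Finset.mem_filter, Finset.mem_univ, true_and] at hi hmax
    let u : Fin k → F[X] := fun i' => monomial (rowDeg G i - rowDeg G i') (c i')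
    have hu : ∀ i', u i' ≠ 0 → (u i').natDegree + rowDeg G i' ≤ rowDeg G i := by
      intro i' hi'
      have hci : c i' ≠ 0 := by simpa [u] using hi'
      have := hmax i' hci
      simp only [u, natDegree_monomial, hci, if_false]
      omega
    obtain ⟨hne, hd⟩ := degP_vecMul hlead hu ⟨i, by simpa [u] using hi, by simp [u]⟩
    obtain ⟨hne', hd'⟩ := hdeg' u hne
    obtain ⟨j, hj⟩ := exists_coeff_degP_ne_zero hne'
    rw [hd', hd, coeff_vecMul (by simpa only [hrow] using hu)] at hj
    refine hj ?_
    simp only [hrow, u, coeff_monomial_same]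
    exact congrFun hc j
  have hred := isRowReduced_of_leadMat hleadbar
  refine ⟨hred, hrow, ?_⟩
  exact hred.symm.trans ((Finset.sum_congr rfl fun i _ => hrow i).trans hGred)
end

section
/- The controller canonical form realizes the encoder: let G ∈ F[z]^{k×n} be basic and reduced with row degrees ν_1, …, ν_k, δ = Σ_i ν_i, and CCF (A,B,C,D). For all u = Σ_t u_t z^t ∈ F[z]^k and v = Σ_t v_t z^t ∈ F[z]^n (u_t ∈ F^k, v_t ∈ F^n), one has v = uG if and only if the sequence (x_t)_{t≥0} in F^δ defined by x_0 = 0 and x_{t+1} = x_t A + u_t B satisfies v_t = x_t C + u_t D for all t ≥ 0. -/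
open Matrix Polynomial

variable {F : Type*} [Field F]

/-- Index set for the state space of the controller canonical form with row degrees `ν`. -/
abbrev StateIdx {k : ℕ} (ν : Fin k → ℕ) := (i : Fin k) × Fin (ν i)

/-- The matrix `A` of the controller canonical form. -/
def ccfA {k : ℕ} (ν : Fin k → ℕ) : Matrix (StateIdx ν) (StateIdx ν) F :=
  fun p q => if p.1 = q.1 ∧ (q.2 : ℕ) = (p.2 : ℕ) + 1 then 1 else 0

/-- The matrix `B` of the controller canonical form. -/
def ccfB {k : ℕ} (ν : Fin k → ℕ) : Matrix (Fin k) (StateIdx ν) F :=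
  fun i q => if i = q.1 ∧ (q.2 : ℕ) = 0 then 1 else 0

/-- The matrix `C` of the controller canonical form of `G`. -/
def ccfC {k n : ℕ} (G : Matrix (Fin k) (Fin n) (Polynomial F)) :
    Matrix (StateIdx (rowDeg G)) (Fin n) F :=
  fun p j => (G p.1 j).coeff ((p.2 : ℕ) + 1)

/-- The matrix `D` of the controller canonical form of `G`. -/
def ccfD {k n : ℕ} (G : Matrix (Fin k) (Fin n) (Polynomial F)) :
    Matrix (Fin k) (Fin n) F :=
  fun i j => (G i j).coeff 0


theorem ccf_state_apply {k : ℕ} (ν : Fin k → ℕ) (u : Fin k → Polynomial F)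
    (x : ℕ → StateIdx ν → F) (hx0 : x 0 = 0)
    (hx : ∀ t, x (t + 1) = x t ᵥ* ccfA ν + (fun i => (u i).coeff t) ᵥ* ccfB ν)
    (t : ℕ) (i : Fin k) (l : Fin (ν i)) :
    x t ⟨i, l⟩ = if (l : ℕ) < t then (u i).coeff (t - (l + 1)) else 0 := by
  induction t generalizing l with
  | zero => simp [hx0]
  | succ t ih =>
    rw [hx]
    obtain ⟨l, hl⟩ := l
    simp only [Pi.add_apply, Matrix.vecMul, dotProduct, ccfA, ccfB]
    cases l with
    | zero => simp
    | succ m =>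
      have hm : m < ν i := by omega
      rw [Finset.sum_eq_single (⟨i, ⟨m, hm⟩⟩ : StateIdx ν)]
      · simp [ih]
      · rintro ⟨i', l'⟩ - hne
        rw [if_neg, mul_zero]
        rintro ⟨h, h'⟩
        dsimp only at h h'
        subst h
        apply hne
        congr 1
        ext
        dsimp only
        omega
      · simp

theorem coeff_mul_eq_sum_of_natDegree_le {p q : Polynomial F} {d : ℕ} (hq : q.natDegree ≤ d)
    (t : ℕ) :
    (p * q).coeff t =
      (∑ l : Fin d, (if (l : ℕ) < t then p.coeff (t - (l + 1)) else 0) * q.coeff (l + 1)) +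
        p.coeff t * q.coeff 0 := by
  rw [mul_comm, coeff_mul, Finset.Nat.sum_antidiagonal_eq_sum_range_succ_mk,
    Finset.sum_range_succ', Nat.sub_zero, mul_comm (q.coeff 0),
    Fin.sum_univ_eq_sum_range
      fun l => (if l < t then p.coeff (t - (l + 1)) else 0) * q.coeff (l + 1)]
  congr 1
  rw [Finset.sum_subset (Finset.range_subset_range.2 (le_max_left d t)),
    ← Finset.sum_subset (Finset.range_subset_range.2 (le_max_right d t))]
  · refine Finset.sum_congr rfl fun l hl => ?_
    rw [if_pos (Finset.mem_range.1 hl), mul_comm]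
  · intro l _ hl
    rw [if_neg (by simpa using hl), zero_mul]
  · intro l _ hl
    have hdl : d ≤ l := by simpa using hl
    rw [coeff_eq_zero_of_natDegree_lt (p := q) (by omega), mul_zero]

/-- The controller canonical form realizes the encoder: `v = uG` iff the state
sequence started at `0` and driven by the coefficients of `u` produces the
coefficients of `v`. -/
theorem stmt10 {F : Type*} [Field F] [Fintype F] {k n : ℕ}
    (G : Matrix (Fin k) (Fin n) (Polynomial F)) (hG : IsBasic G) (hGred : IsRowReduced G)
    (u : Fin k → Polynomial F) (v : Fin n → Polynomial F)
    (x : ℕ → StateIdx (rowDeg G) → F) (hx0 : x 0 = 0)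
    (hx : ∀ t, x (t + 1) =
      x t ᵥ* ccfA (rowDeg G) + (fun i => (u i).coeff t) ᵥ* ccfB (rowDeg G)) :
    v = u ᵥ* G ↔
      ∀ t, (fun j => (v j).coeff t) =
        x t ᵥ* ccfC G + (fun i => (u i).coeff t) ᵥ* ccfD G := by
  have key : ∀ t j, (x t ᵥ* ccfC G + (fun i => (u i).coeff t) ᵥ* ccfD G) j =
      ((u ᵥ* G) j).coeff t := by
    intro t j
    simp only [Pi.add_apply, Matrix.vecMul, dotProduct, ccfC, ccfD, finsetSum_coeff,
      Fintype.sum_sigma, ccf_state_apply (rowDeg G) u x hx0 hx]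
    rw [← Finset.sum_add_distrib]
    refine Finset.sum_congr rfl fun i _ => (coeff_mul_eq_sum_of_natDegree_le ?_ t).symm
    exact Finset.le_sup (f := fun j => (G i j).natDegree) (Finset.mem_univ j)
  constructor
  · rintro rfl t
    exact funext fun j => (key t j).symm
  · intro h
    ext j t
    rw [← key, ← h t]
end
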